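/- arXiv:2312.12846 — 10 statements merged into one kernel-verified Lean document; each statement's English description precedes it below -/
import Mathlib

section
/- Let α ∈ (1,2), σ = 1 - α/2, τ > 0, and let k ≥ 1 be an integer. Then ∫_{t_{k-1/2}}^{t_{k+σ}} (s - t_k)(t_{k+σ} - s)^{1-α} ds = 0, where t_r = rτ for real r; equivalently, ∫_{t_{k-1/2}}^{t_{k+σ}} (s - t_k)(t_{k+σ} - s)^{1-α} ds = (1/((2-α)(3-α))) τ^{3-α} (σ + 1/2)^{2-α} (σ - (1 - α/2)). -/
open MeasureTheory

/-- A linear factor integrated against the weight `(b - s) ^ r`, which may be singular at `b`. -/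
theorem integral_sub_mul_sub_rpow {r L : ℝ} (b m : ℝ) (hr : -1 < r) (hL : 0 ≤ L) :
    ∫ s in (b - L)..b, (s - m) * (b - s) ^ r =
      L ^ (r + 1) * ((b - m) / (r + 1) - L / (r + 2)) := by
  have hsubst := intervalIntegral.integral_comp_sub_left
    (fun x : ℝ => (b - m - x) * x ^ r) (a := b - L) (b := b) b
  simp only [sub_self, sub_sub_cancel] at hsubst
  have hleft : ∫ s in (b - L)..b, (s - m) * (b - s) ^ r =
      ∫ s in (b - L)..b, (b - m - (b - s)) * (b - s) ^ r := by
    congr 1 with s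
    ring
  have hsplit : ∫ x in (0 : ℝ)..L, (b - m - x) * x ^ r =
      ∫ x in (0 : ℝ)..L, ((b - m) * x ^ r - x ^ (r + 1)) := by
    refine intervalIntegral.integral_congr fun x hx => ?_
    rw [Set.uIcc_of_le hL] at hx
    rw [Real.rpow_add_one' hx.1 (by linarith)]
    ring
  rw [hleft, hsubst, hsplit, intervalIntegral.integral_sub
    ((intervalIntegral.intervalIntegrable_rpow' hr).const_mul _)
    (intervalIntegral.intervalIntegrable_rpow' (by linarith)),
    intervalIntegral.integral_const_mul, integral_rpow (Or.inl hr),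
    integral_rpow (Or.inl (by linarith)), Real.zero_rpow (by linarith),
    Real.zero_rpow (by linarith), Real.rpow_add_one' (y := r + 1) hL (by linarith)]
  ring

/-- The key vanishing integral identity at the super-convergence point
`t_{k+σ}` with `σ = 1 - α/2`: the integral `∫_{t_{k-1/2}}^{t_{k+σ}} (s - t_k)(t_{k+σ}-s)^{1-α} ds`
is zero, and equals the displayed closed-form expression. -/
theorem superconvergence_integral_zero (α τ : ℝ) (hα1 : 1 < α) (hα2 : α < 2)
    (hτ : 0 < τ) (k : ℕ) (hk : 1 ≤ k) :
    (∫ s in (((k : ℝ) - 1/2) * τ)..(((k : ℝ) + (1 - α/2)) * τ),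
        (s - (k : ℝ) * τ) * ((((k : ℝ) + (1 - α/2)) * τ) - s) ^ (1 - α)) = 0 ∧
    (∫ s in (((k : ℝ) - 1/2) * τ)..(((k : ℝ) + (1 - α/2)) * τ),
        (s - (k : ℝ) * τ) * ((((k : ℝ) + (1 - α/2)) * τ) - s) ^ (1 - α)) =
      (1 / ((2 - α) * (3 - α))) * τ ^ (3 - α) * ((1 - α/2) + 1/2) ^ (2 - α) *
        ((1 - α/2) - (1 - α/2)) := by
  have hzero : (∫ s in (((k : ℝ) - 1/2) * τ)..(((k : ℝ) + (1 - α/2)) * τ),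
      (s - (k : ℝ) * τ) * ((((k : ℝ) + (1 - α/2)) * τ) - s) ^ (1 - α)) = 0 := by
    have hlower : ((k : ℝ) - 1/2) * τ =
        ((k : ℝ) + (1 - α/2)) * τ - (3 - α) / 2 * τ := by ring
    have h2 : 1 - α + 1 ≠ 0 := by linarith
    have h3 : 1 - α + 2 ≠ 0 := by linarith
    rw [hlower, integral_sub_mul_sub_rpow _ _ (by linarith)
      (mul_nonneg (by linarith) hτ.le)]
    refine mul_eq_zero_of_right _ ?_
    field_simp
    ring
  exact ⟨hzero, by rw [hzero, sub_self, mul_zero]⟩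
end

section
/- Let τ > 0 and let p : ℝ → ℝ be four times continuously differentiable on [0, 2τ]. Define H''_{3,0}(t) = δ_t² p¹ · (t - t_{1/3})/(t₁ - t_{1/3}) + δ_t² p⁰ · (t₁ - t)/(t₁ - t_{1/3}), where t_{1/3} = τ/3 and t₁ = τ. Then for every t ∈ [0, τ/2], |p''(t) − H''_{3,0}(t)| ≤ (299/648) τ² · max_{0 ≤ s ≤ 2τ} |p⁗(s)|. -/
open MeasureTheory

/-- `δ_t² p^j` : second difference quotient, with the special definition at `j = 0`
using `p'(0)`. -/
noncomputable def dt2 (τ : ℝ) (p : ℝ → ℝ) (j : ℕ) : ℝ :=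
  if j = 0 then (2 / τ) * ((p τ - p 0) / τ - deriv p 0)
  else (p (((j : ℝ) + 1) * τ) - 2 * p ((j : ℝ) * τ) + p (((j : ℝ) - 1) * τ)) / τ ^ 2

/-- A twice differentiable function with nonnegative second derivative on `[a, b]` lies above
its tangent lines there. -/
lemma tangent_le_of_second_deriv_nonneg {f f' f'' : ℝ → ℝ} {a b : ℝ}
    (hf : ∀ x, HasDerivAt f (f' x) x) (hf' : ∀ x, HasDerivAt f' (f'' x) x)
    (hnonneg : ∀ x ∈ Set.Icc a b, 0 ≤ f'' x) {x y : ℝ}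
    (hx : x ∈ Set.Icc a b) (hy : y ∈ Set.Icc a b) :
    f x + f' x * (y - x) ≤ f y := by
  have hconv : ConvexOn ℝ (Set.Icc a b) f :=
    convexOn_of_hasDerivWithinAt2_nonneg (convex_Icc a b)
      (fun z _ => (hf z).continuousAt.continuousWithinAt)
      (fun z _ => (hf z).hasDerivWithinAt) (fun z _ => (hf' z).hasDerivWithinAt)
      (fun z hz => hnonneg z (interior_subset hz))
  rcases lt_trichotomy x y with h | h | h
  · have := hconv.le_slope_of_hasDerivAt hx hy h (hf x)
    rw [slope_def_field, le_div_iff₀ (by linarith)] at this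
    linarith
  · subst h; simp
  · have := hconv.slope_le_of_hasDerivAt hy hx h (hf x)
    rw [slope_def_field, div_le_iff₀ (by linarith)] at this
    linarith

/-- If the fourth derivative of `p` is at most `M` on `[a, b]`, then the fourth-order Taylor
majorant of `p` about `t`, minus `p`, lies above its tangent lines on `[a, b]`. -/
lemma tangent_le_quartic_sub {p p₁ p₂ p₃ p₄ : ℝ → ℝ} {a b M t : ℝ}
    (h₁ : ∀ x, HasDerivAt p (p₁ x) x) (h₂ : ∀ x, HasDerivAt p₁ (p₂ x) x)
    (h₃ : ∀ x, HasDerivAt p₂ (p₃ x) x) (h₄ : ∀ x, HasDerivAt p₃ (p₄ x) x)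
    (hM : ∀ x ∈ Set.Icc a b, p₄ x ≤ M) (ht : t ∈ Set.Icc a b) {x y : ℝ}
    (hx : x ∈ Set.Icc a b) (hy : y ∈ Set.Icc a b) :
    (M * (x - t) ^ 4 / 24 + p₃ t * (x - t) ^ 3 / 6 + p₂ t * (x - t) ^ 2 / 2 - p x)
      + (M * (x - t) ^ 3 / 6 + p₃ t * (x - t) ^ 2 / 2 + p₂ t * (x - t) - p₁ x) * (y - x)
      ≤ M * (y - t) ^ 4 / 24 + p₃ t * (y - t) ^ 3 / 6 + p₂ t * (y - t) ^ 2 / 2 - p y := by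
  have hpow : ∀ (n : ℕ) (z : ℝ), HasDerivAt (fun z => (z - t) ^ n) (n * (z - t) ^ (n - 1)) z :=
    fun n z => by simpa using ((hasDerivAt_id z).sub_const t).fun_pow n
  refine tangent_le_of_second_deriv_nonneg (a := a) (b := b)
    (f := fun z => M * (z - t) ^ 4 / 24 + p₃ t * (z - t) ^ 3 / 6 + p₂ t * (z - t) ^ 2 / 2 - p z)
    (f' := fun z => M * (z - t) ^ 3 / 6 + p₃ t * (z - t) ^ 2 / 2 + p₂ t * (z - t) - p₁ z)
    (f'' := fun z => M * (z - t) ^ 2 / 2 + p₃ t * (z - t) + p₂ t - p₂ z)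
    (fun z => ?_) (fun z => ?_) (fun z hz => ?_) hx hy
  · refine (((((hpow 4 z).const_mul M).div_const 24).add
      (((hpow 3 z).const_mul (p₃ t)).div_const 6)).add
      (((hpow 2 z).const_mul (p₂ t)).div_const 2)).sub (h₁ z) |>.congr_deriv ?_
    norm_num
    ring
  · refine (((((hpow 3 z).const_mul M).div_const 6).add
      (((hpow 2 z).const_mul (p₃ t)).div_const 2)).add
      (((hasDerivAt_id z).sub_const t).const_mul (p₂ t))).sub (h₂ z) |>.congr_deriv ?_
    norm_num
    ring
  · have := tangent_le_of_second_deriv_nonneg (a := a) (b := b)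
      (f := fun z => M * (z - t) ^ 2 / 2 - p₂ z) (f' := fun z => M * (z - t) - p₃ z)
      (f'' := fun z => M - p₄ z)
      (fun z => by
        refine (((hpow 2 z).const_mul M).div_const 2).sub (h₃ z) |>.congr_deriv ?_
        norm_num
        ring)
      (fun z => by
        refine (((hasDerivAt_id z).sub_const t).const_mul M).sub (h₄ z) |>.congr_deriv ?_
        norm_num)
      (fun z hz => sub_nonneg.2 (hM z hz)) ht hz
    norm_num at this
    linarith

/-- One-sided bounds for the errors of the difference quotients `dt2 τ p 1` and `dt2 τ p 0`
against the linear Taylor polynomial of the second derivative about `t`. -/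
lemma dt2_le_taylor {τ : ℝ} (hτ : 0 < τ) {p p₁ p₂ p₃ p₄ : ℝ → ℝ} {M t : ℝ}
    (h₁ : ∀ x, HasDerivAt p (p₁ x) x) (h₂ : ∀ x, HasDerivAt p₁ (p₂ x) x)
    (h₃ : ∀ x, HasDerivAt p₂ (p₃ x) x) (h₄ : ∀ x, HasDerivAt p₃ (p₄ x) x)
    (hM : ∀ x ∈ Set.Icc 0 (2 * τ), p₄ x ≤ M) (ht : t ∈ Set.Icc 0 (2 * τ)) :
    dt2 τ p 1 ≤ p₂ t + p₃ t * (τ - t) + M * ((τ - t) ^ 2 / 2 + τ ^ 2 / 12) ∧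
    dt2 τ p 0 ≤ p₂ t + p₃ t * (τ / 3 - t) + M * ((τ / 3 - t) ^ 2 / 2 + τ ^ 2 / 36) := by
  have m0 : (0 : ℝ) ∈ Set.Icc 0 (2 * τ) := ⟨le_rfl, by linarith⟩
  have m1 : τ ∈ Set.Icc 0 (2 * τ) := ⟨hτ.le, by linarith⟩
  have m2 : 2 * τ ∈ Set.Icc 0 (2 * τ) := ⟨by linarith, le_rfl⟩
  have key := fun {x y : ℝ} => tangent_le_quartic_sub (x := x) (y := y) h₁ h₂ h₃ h₄ hM ht
  constructor
  · have e : dt2 τ p 1 = (p (2 * τ) - 2 * p τ + p 0) / τ ^ 2 := by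
      norm_num [dt2]
    rw [e, div_le_iff₀ (by positivity)]
    linarith [key m1 m0, key m1 m2]
  · have e : dt2 τ p 0 = 2 * (p τ - p 0 - τ * p₁ 0) / τ ^ 2 := by
      simp only [dt2, if_true, (h₁ 0).deriv]
      field_simp
    rw [e, div_le_iff₀ (by positivity)]
    linarith [key m0 m1]

lemma dt2_neg (τ : ℝ) (p : ℝ → ℝ) (j : ℕ) : dt2 τ (fun x => -p x) j = -dt2 τ p j := by
  unfold dt2
  split_ifs
  · rw [deriv.fun_neg]; ring
  · ring

/-- The weighted sum of the two interpolation-node errors on `[0, τ / 2]`. -/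
lemma weighted_node_error_le {τ t : ℝ} (hτ : 0 < τ) (ht0 : 0 ≤ t) (ht2 : t ≤ τ / 2) :
    ((τ - t) ^ 2 / 2 + τ ^ 2 / 12) * |t - τ / 3|
      + ((τ / 3 - t) ^ 2 / 2 + τ ^ 2 / 36) * (τ - t) ≤ 299 / 648 * τ ^ 2 * (τ - τ / 3) := by
  have hτt : 0 ≤ τ - t := by linarith
  rcases abs_cases (t - τ / 3) with ⟨h, h'⟩ | ⟨h, h'⟩ <;> rw [h]
  · have a1 : (τ - t) ^ 2 ≤ τ ^ 2 := by nlinarith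
    have a2 : (τ / 3 - t) ^ 2 ≤ (τ / 6) ^ 2 := by nlinarith
    nlinarith [mul_nonneg (sub_nonneg.2 a1) h', mul_nonneg (sub_nonneg.2 a2) hτt,
      pow_pos hτ 3, mul_nonneg (sq_nonneg τ) (sub_nonneg.2 ht2),
      mul_nonneg (sq_nonneg τ) ht0]
  · have a1 : (τ - t) ^ 2 ≤ τ ^ 2 := by nlinarith
    have a2 : (τ / 3 - t) ^ 2 ≤ (τ / 3) ^ 2 := by nlinarith
    nlinarith [mul_nonneg (sub_nonneg.2 a1) (neg_nonneg.2 h'.le),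
      mul_nonneg (sub_nonneg.2 a2) hτt, pow_pos hτ 3,
      mul_nonneg (sq_nonneg τ) ht0]

/-- Error of the second derivative of the cubic Hermite interpolation on the
first half-interval `[0, τ/2]`:
`|p''(t) - H''_{3,0}(t)| ≤ (299/648) τ² max_{[0,2τ]} |p⁗|`. -/
theorem hermite_H3_second_deriv_error (τ : ℝ) (hτ : 0 < τ) (p : ℝ → ℝ)
    (hp : ContDiff ℝ 4 p) :
    ∀ t ∈ Set.Icc (0:ℝ) (τ/2),
      |deriv (deriv p) t -
        (dt2 τ p 1 * ((t - τ/3) / (τ - τ/3)) + dt2 τ p 0 * ((τ - t) / (τ - τ/3)))|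
      ≤ (299/648) * τ ^ 2 *
          sSup ((fun s => |iteratedDeriv 4 p s|) '' Set.Icc 0 (2*τ)) := by
  intro t ht
  set M := sSup ((fun s => |iteratedDeriv 4 p s|) '' Set.Icc 0 (2*τ)) with hMdef
  have hM : ∀ x ∈ Set.Icc 0 (2 * τ), |iteratedDeriv 4 p x| ≤ M := fun x hx =>
    le_csSup (isCompact_Icc.image
      (hp.continuous_iteratedDeriv 4 le_rfl).abs).bddAbove (Set.mem_image_of_mem _ hx)
  have hd : ∀ k : ℕ, k < 4 → ∀ x,
      HasDerivAt (iteratedDeriv k p) (iteratedDeriv (k + 1) p x) x := fun k hk x => by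
    rw [iteratedDeriv_succ]
    exact (hp.differentiable_iteratedDeriv k (by exact_mod_cast hk) x).hasDerivAt
  have h₁ : ∀ x, HasDerivAt p (iteratedDeriv 1 p x) x := by
    simpa using hd 0 (by norm_num)
  have h₂ := hd 1 (by norm_num)
  have h₃ := hd 2 (by norm_num)
  have h₄ := hd 3 (by norm_num)
  have ht' : t ∈ Set.Icc 0 (2 * τ) := ⟨ht.1, by linarith [ht.2]⟩
  have hM0 : 0 ≤ M := (abs_nonneg _).trans (hM t ht')
  obtain ⟨u1, u0⟩ := dt2_le_taylor hτ h₁ h₂ h₃ h₄ (fun x hx => (abs_le.1 (hM x hx)).2) ht'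
  obtain ⟨l1, l0⟩ := dt2_le_taylor (M := M) hτ (fun x => (h₁ x).fun_neg) (fun x => (h₂ x).fun_neg)
    (fun x => (h₃ x).fun_neg) (fun x => (h₄ x).fun_neg)
    (fun x hx => by linarith [(abs_le.1 (hM x hx)).1]) ht'
  rw [dt2_neg] at l1 l0
  have e2 : deriv (deriv p) t = iteratedDeriv 2 p t := by
    rw [iteratedDeriv_succ, iteratedDeriv_one]
  rw [e2]
  norm_num at u1 u0 l1 l0
  generalize iteratedDeriv 2 p t = q at *
  generalize iteratedDeriv 3 p t = q' at *
  generalize dt2 τ p 1 = D1 at *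
  generalize dt2 τ p 0 = D0 at *
  set B1 := (τ - t) ^ 2 / 2 + τ ^ 2 / 12 with hB1
  set B0 := (τ / 3 - t) ^ 2 / 2 + τ ^ 2 / 36 with hB0
  have b1 : |D1 - (q + q' * (τ - t))| ≤ M * B1 := abs_le.2 ⟨by linarith, by linarith⟩
  have b0 : |D0 - (q + q' * (τ / 3 - t))| ≤ M * B0 := abs_le.2 ⟨by linarith, by linarith⟩
  have e : q - (D1 * ((t - τ/3) / (τ - τ/3)) + D0 * ((τ - t) / (τ - τ/3))) =
      -((D1 - (q + q' * (τ - t))) * ((t - τ/3) / (τ - τ/3))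
        + (D0 - (q + q' * (τ / 3 - t))) * ((τ - t) / (τ - τ/3))) := by
    have : τ - τ / 3 ≠ 0 := by linarith
    field_simp
    ring
  have hden : 0 < τ - τ / 3 := by linarith
  have hτt : 0 ≤ τ - t := by linarith [ht.2]
  have hpoly := weighted_node_error_le hτ ht.1 ht.2
  rw [← hB1, ← hB0] at hpoly
  clear_value M B1 B0
  rw [e, abs_neg]
  calc _ ≤ M * B1 * (|t - τ/3| / (τ - τ/3)) + M * B0 * ((τ - t) / (τ - τ/3)) := by
        refine (abs_add_le _ _).trans ?_
        rw [abs_mul, abs_mul, abs_div, abs_div, abs_of_pos hden, abs_of_nonneg hτt]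
        gcongr
    _ = M * ((B1 * |t - τ / 3| + B0 * (τ - t)) / (τ - τ / 3)) := by ring
    _ ≤ M * (299 / 648 * τ ^ 2) := by
        gcongr
        rwa [div_le_iff₀ hden]
    _ = _ := by ring
end

section
/- Let τ > 0, let l ≥ 1 be an integer, and let p : ℝ → ℝ be four times continuously differentiable on [(l-1)τ, (l+2)τ]. Define N''_{3,l}(t) = δ_t² p^{l+1} · (t - t_l)/τ + δ_t² p^l · (t_{l+1} - t)/τ. Then for every t ∈ [t_{l-1/2}, t_{l+1/2}], |p''(t) − N''_{3,l}(t)| ≤ (5/6) τ² · max_{t_{l-1} ≤ s ≤ t_{l+2}} |p⁗(s)|. -/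
open MeasureTheory

/-- Taylor's theorem on either side of `a`, with the Lagrange bound on the remainder. -/
theorem abs_sub_taylor_sum_le {f : ℝ → ℝ} {n : ℕ} (hf : ContDiff ℝ (n + 1) f) {a x M : ℝ}
    (hM : ∀ y ∈ Set.uIcc a x, |iteratedDeriv (n + 1) f y| ≤ M) :
    |f x - ∑ k ∈ Finset.range (n + 1), iteratedDeriv k f a * (x - a) ^ k / k.factorial|
      ≤ M * |x - a| ^ (n + 1) / (n + 1).factorial := by
  rcases eq_or_ne a x with rfl | hax
  · simp [Finset.sum_range_succ']
  obtain ⟨y, hy, h⟩ := taylor_mean_remainder_lagrange_iteratedDeriv hax hf.contDiffOn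
  have hsum : taylorWithinEval f n (Set.uIcc a x) a x =
      ∑ k ∈ Finset.range (n + 1), iteratedDeriv k f a * (x - a) ^ k / k.factorial := by
    rw [taylor_within_apply]
    refine Finset.sum_congr rfl fun k hk => ?_
    have hkn : (k : WithTop ℕ∞) ≤ n + 1 := by
      exact_mod_cast (Finset.mem_range.mp hk).le
    rw [iteratedDerivWithin_eq_iteratedDeriv (uniqueDiffOn_uIcc hax)
      (hf.of_le hkn).contDiffAt Set.left_mem_uIcc, smul_eq_mul]
    ring
  rw [← hsum, h, abs_div, abs_mul, abs_pow, Nat.abs_cast]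
  gcongr
  exact hM y (Set.Ioo_subset_Icc_self hy)

/-- Error of the second derivative of the cubic Newton interpolation on
`[t_{l-1/2}, t_{l+1/2}]`:
`|p''(t) - N''_{3,l}(t)| ≤ (5/6) τ² max_{[t_{l-1}, t_{l+2}]} |p⁗|`. -/
theorem newton_N3_second_deriv_error (τ : ℝ) (hτ : 0 < τ) (l : ℕ) (hl : 1 ≤ l)
    (p : ℝ → ℝ) (hp : ContDiff ℝ 4 p) :
    ∀ t ∈ Set.Icc (((l : ℝ) - 1/2) * τ) (((l : ℝ) + 1/2) * τ),
      |deriv (deriv p) t -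
        (dt2 τ p (l+1) * ((t - (l : ℝ) * τ) / τ) +
         dt2 τ p l * ((((l : ℝ) + 1) * τ - t) / τ))|
      ≤ (5/6) * τ ^ 2 *
          sSup ((fun s => |iteratedDeriv 4 p s|) ''
            Set.Icc (((l : ℝ) - 1) * τ) (((l : ℝ) + 2) * τ)) := by
  intro t ht
  set M := sSup ((fun s => |iteratedDeriv 4 p s|) ''
    Set.Icc (((l : ℝ) - 1) * τ) (((l : ℝ) + 2) * τ))
  set a : ℝ := (l : ℝ) * τ with ha
  have hcont : Continuous fun s => |iteratedDeriv 4 p s| :=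
    (hp.continuous_iteratedDeriv 4 le_rfl).abs
  have hM : ∀ s ∈ Set.Icc (a - τ) (a + 2 * τ), |iteratedDeriv 4 p s| ≤ M := by
    intro s hs
    refine le_csSup (isCompact_Icc.image hcont).bddAbove (Set.mem_image_of_mem _ ?_)
    constructor <;> linarith [hs.1, hs.2]
  have hbound : ∀ x ∈ Set.Icc (a - τ) (a + 2 * τ), ∀ y ∈ Set.uIcc a x,
      |iteratedDeriv 4 p y| ≤ M := fun x hx y hy =>
    hM y (Set.uIcc_subset_Icc ⟨by linarith, by linarith⟩ hx hy)
  have hpoint : ∀ x ∈ Set.Icc (a - τ) (a + 2 * τ),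
      |p x - (p a + iteratedDeriv 1 p a * (x - a) + iteratedDeriv 2 p a * (x - a) ^ 2 / 2
        + iteratedDeriv 3 p a * (x - a) ^ 3 / 6)| ≤ M * |x - a| ^ 4 / 24 := by
    intro x hx
    have h := abs_sub_taylor_sum_le (n := 3) (by exact_mod_cast hp) (hbound x hx)
    simpa [Finset.sum_range_succ, Nat.factorial] using h
  have hp2 : ContDiff ℝ 2 (iteratedDeriv 2 p) := by
    rw [iteratedDeriv_eq_iterate]
    exact hp.iterate_deriv' 2 2
  have hderiv (m k : ℕ) : iteratedDeriv m (iteratedDeriv k p) = iteratedDeriv (m + k) p := by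
    simp only [iteratedDeriv_eq_iterate, Function.iterate_add_apply]
  have ht1 : -(τ / 2) ≤ t - a := by linarith [ht.1]
  have ht2 : t - a ≤ τ / 2 := by linarith [ht.2]
  have hsecond : |deriv (deriv p) t - (iteratedDeriv 2 p a + iteratedDeriv 3 p a * (t - a))|
      ≤ M * |t - a| ^ 2 / 2 := by
    have h := abs_sub_taylor_sum_le (f := iteratedDeriv 2 p) (n := 1) (a := a) (x := t) (M := M)
      (by exact_mod_cast hp2)
      (by rw [hderiv]; exact hbound t ⟨by linarith, by linarith⟩)
    have h2 : deriv (deriv p) = iteratedDeriv 2 p := by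
      simp [iteratedDeriv_succ, iteratedDeriv_zero]
    simp only [Finset.sum_range_succ, Finset.sum_range_zero, hderiv] at h
    simpa [h2] using h
  have hr₁ := hpoint (a + τ) ⟨by linarith, by linarith⟩
  have hr₂ := hpoint (a + 2 * τ) ⟨by linarith, by linarith⟩
  have hr₃ := hpoint (a - τ) ⟨by linarith, by linarith⟩
  rw [show a + τ - a = τ by ring, abs_of_pos hτ] at hr₁
  rw [show a + 2 * τ - a = 2 * τ by ring, abs_of_pos (show 0 < 2 * τ by positivity)] at hr₂
  rw [show a - τ - a = -τ by ring, abs_neg, abs_of_pos hτ] at hr₃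
  have hM0 : 0 ≤ M := (abs_nonneg _).trans (hM a ⟨by linarith, by linarith⟩)
  set d₂ := iteratedDeriv 2 p a
  set d₃ := iteratedDeriv 3 p a
  have hτ2 : 0 < τ ^ 2 := by positivity
  have hD₀ : |dt2 τ p l - d₂| ≤ M * τ ^ 2 / 12 := by
    have hval : dt2 τ p l = (p (a + τ) - 2 * p a + p (a - τ)) / τ ^ 2 := by
      rw [dt2, if_neg (by omega), ha]
      ring_nf
    rw [hval, show (p (a + τ) - 2 * p a + p (a - τ)) / τ ^ 2 - d₂ =
      (p (a + τ) - 2 * p a + p (a - τ) - d₂ * τ ^ 2) / τ ^ 2 by field_simp,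
      abs_div, abs_of_pos hτ2, div_le_iff₀ hτ2]
    rw [abs_le] at hr₁ hr₃ ⊢
    constructor <;> linarith [hr₁.1, hr₁.2, hr₃.1, hr₃.2]
  have hD₁ : |dt2 τ p (l + 1) - (d₂ + d₃ * τ)| ≤ 3 * M * τ ^ 2 / 4 := by
    have hval : dt2 τ p (l + 1) = (p (a + 2 * τ) - 2 * p (a + τ) + p a) / τ ^ 2 := by
      rw [dt2, if_neg (by omega), ha]
      push_cast
      ring_nf
    rw [hval, show (p (a + 2 * τ) - 2 * p (a + τ) + p a) / τ ^ 2 - (d₂ + d₃ * τ) =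
      (p (a + 2 * τ) - 2 * p (a + τ) + p a - (d₂ + d₃ * τ) * τ ^ 2) / τ ^ 2 by field_simp,
      abs_div, abs_of_pos hτ2, div_le_iff₀ hτ2]
    rw [abs_le] at hr₁ hr₂ ⊢
    constructor <;> linarith [hr₁.1, hr₁.2, hr₂.1, hr₂.2]
  set x := (t - a) / τ with hx
  have hta : t - a = x * τ := by rw [hx]; field_simp
  have hx' : ((l : ℝ) + 1) * τ - t = (1 - x) * τ := by linarith [hta]
  rw [hx', mul_div_assoc, div_self hτ.ne', mul_one]
  have hx1 : |x| ≤ 1 / 2 := by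
    rw [abs_le]
    constructor
    · rw [hx, le_div_iff₀ hτ]; linarith
    · rw [hx, div_le_iff₀ hτ]; linarith
  have hx2 : |1 - x| ≤ 3 / 2 := by
    rw [abs_le] at hx1 ⊢
    constructor <;> linarith [hx1.1, hx1.2]
  have hE : |deriv (deriv p) t - (d₂ + d₃ * (t - a))| ≤ M * τ ^ 2 / 8 := by
    have : |t - a| ≤ τ / 2 := abs_le.mpr ⟨ht1, ht2⟩
    calc _ ≤ M * |t - a| ^ 2 / 2 := hsecond
      _ ≤ M * (τ / 2) ^ 2 / 2 := by gcongr
      _ = M * τ ^ 2 / 8 := by ring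
  calc |deriv (deriv p) t - (dt2 τ p (l + 1) * x + dt2 τ p l * (1 - x))|
      = |(deriv (deriv p) t - (d₂ + d₃ * (t - a))) - (dt2 τ p (l + 1) - (d₂ + d₃ * τ)) * x
          - (dt2 τ p l - d₂) * (1 - x)| := by rw [hta]; ring_nf
    _ ≤ |deriv (deriv p) t - (d₂ + d₃ * (t - a))| + |dt2 τ p (l + 1) - (d₂ + d₃ * τ)| * |x|
          + |dt2 τ p l - d₂| * |1 - x| := by
        rw [← abs_mul, ← abs_mul]
        exact (abs_sub _ _).trans (by gcongr; exact abs_sub _ _)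
    _ ≤ M * τ ^ 2 / 8 + 3 * M * τ ^ 2 / 4 * (1 / 2) + M * τ ^ 2 / 12 * (3 / 2) := by gcongr
    _ ≤ 5 / 6 * τ ^ 2 * M := by nlinarith [mul_nonneg hM0 hτ2.le]
end

section
/- Let τ > 0 and let p : ℝ → ℝ be four times continuously differentiable on [0, τ]. Then |p''(τ/3) − δ_t² p⁰| ≤ (29/972) τ² · max_{0 ≤ s ≤ τ} |p⁗(s)|, where δ_t² p⁰ = (2/τ)((p(τ) - p(0))/τ − p'(0)). -/
open MeasureTheory

/-- A function with nonnegative second derivative on a convex set lies above its tangents. -/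
theorem tangent_le_of_hasDerivAt2_nonneg {s : Set ℝ} (hs : Convex ℝ s) {f f' f'' : ℝ → ℝ}
    (hf : ∀ x, HasDerivAt f (f' x) x) (hf' : ∀ x, HasDerivAt f' (f'' x) x)
    (hf'' : ∀ x ∈ s, 0 ≤ f'' x) {x y : ℝ} (hx : x ∈ s) (hy : y ∈ s) :
    f x + f' x * (y - x) ≤ f y := by
  have hc : ConvexOn ℝ s f :=
    convexOn_of_hasDerivWithinAt2_nonneg hs
      (fun z _ => (hf z).continuousAt.continuousWithinAt)
      (fun z _ => (hf z).hasDerivWithinAt) (fun z _ => (hf' z).hasDerivWithinAt)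
      (fun z hz => hf'' z (interior_subset hz))
  rcases lt_trichotomy x y with h | rfl | h
  · have := hc.le_slope_of_hasDerivAt hx hy h (hf x)
    rw [slope_def_field, le_div_iff₀ (sub_pos.2 h)] at this
    linarith
  · simp
  · have := hc.slope_le_of_hasDerivAt hy hx h (hf x)
    rw [slope_def_field, div_le_iff₀ (sub_pos.2 h)] at this
    linarith

/-- If the fourth derivative is nonnegative on `[0, τ]`, the second derivative at `τ / 3` is at
most the second-order difference quotient at `0`. -/
theorem second_deriv_third_le_of_fourth_deriv_nonneg {τ : ℝ} (hτ : 0 < τ)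
    {f f₁ f₂ f₃ f₄ : ℝ → ℝ} (h₁ : ∀ x, HasDerivAt f (f₁ x) x) (h₂ : ∀ x, HasDerivAt f₁ (f₂ x) x)
    (h₃ : ∀ x, HasDerivAt f₂ (f₃ x) x) (h₄ : ∀ x, HasDerivAt f₃ (f₄ x) x)
    (hnn : ∀ x ∈ Set.Icc 0 τ, 0 ≤ f₄ x) :
    f₂ (τ / 3) ≤ (2 / τ) * ((f τ - f 0) / τ - f₁ 0) := by
  have ha : τ / 3 ∈ Set.Icc 0 τ := ⟨by positivity, by linarith⟩
  set a := τ / 3 with ha_def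
  have hd (x : ℝ) : HasDerivAt (fun s : ℝ => s - a) 1 x := (hasDerivAt_id x).sub_const a
  have key := tangent_le_of_hasDerivAt2_nonneg (convex_Icc 0 τ)
    (f := fun s => f s - (f₂ a / 2 * (s - a) ^ 2 + f₃ a / 6 * (s - a) ^ 3))
    (f' := fun s => f₁ s - (f₂ a * (s - a) + f₃ a / 2 * (s - a) ^ 2))
    (f'' := fun s => f₂ s - (f₂ a + f₃ a * (s - a)))
    (fun x => by
      refine ((h₁ x).sub ((((hd x).pow 2).const_mul (f₂ a / 2)).add
        (((hd x).pow 3).const_mul (f₃ a / 6)))).congr_deriv ?_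
      norm_num
      ring)
    (fun x => by
      refine ((h₂ x).sub (((hd x).const_mul (f₂ a)).add
        (((hd x).pow 2).const_mul (f₃ a / 2)))).congr_deriv ?_
      norm_num
      ring)
    (fun x hx => sub_nonneg.2 (tangent_le_of_hasDerivAt2_nonneg (convex_Icc 0 τ) h₃ h₄ hnn ha hx))
    (Set.left_mem_Icc.2 hτ.le) (Set.right_mem_Icc.2 hτ.le)
  have h : f₂ a * τ ^ 2 ≤ 2 * (f τ - f 0 - f₁ 0 * τ) := by
    have e : τ = 3 * a := by rw [ha_def]; ring
    simp only [e] at key ⊢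
    linarith
  calc f₂ a ≤ 2 * (f τ - f 0 - f₁ 0 * τ) / τ ^ 2 := (le_div_iff₀ (by positivity)).2 h
    _ = _ := by field_simp

/-- `|p''(τ/3) - δ_t² p⁰| ≤ (29/972) τ² max_{[0,τ]} |p⁗|`, where
`δ_t² p⁰ = (2/τ)((p(τ)-p(0))/τ - p'(0))`. -/
theorem second_deriv_at_third_error (τ : ℝ) (hτ : 0 < τ) (p : ℝ → ℝ)
    (hp : ContDiff ℝ 4 p) :
    |deriv (deriv p) (τ/3) - (2/τ) * ((p τ - p 0)/τ - deriv p 0)|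
      ≤ (29/972) * τ ^ 2 *
          sSup ((fun s => |iteratedDeriv 4 p s|) '' Set.Icc 0 τ) := by
  set M := sSup ((fun s => |iteratedDeriv 4 p s|) '' Set.Icc 0 τ)
  have hM : ∀ x ∈ Set.Icc 0 τ, |iteratedDeriv 4 p x| ≤ M := fun x hx =>
    le_csSup (isCompact_Icc.bddAbove_image
      (hp.continuous_iteratedDeriv 4 le_rfl).abs.continuousOn) (Set.mem_image_of_mem _ hx)
  have hM0 : 0 ≤ M := (abs_nonneg _).trans (hM 0 (Set.left_mem_Icc.2 hτ.le))
  have hderiv (k : ℕ) (hk : k < 4) (x : ℝ) :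
      HasDerivAt (iteratedDeriv k p) (iteratedDeriv (k + 1) p x) x := by
    rw [iteratedDeriv_succ]
    exact (hp.differentiable_iteratedDeriv k (by exact_mod_cast hk) x).hasDerivAt
  have hpow (n : ℕ) (c x : ℝ) : HasDerivAt (fun s : ℝ => c * s ^ n) (c * (n * x ^ (n - 1))) x :=
    (hasDerivAt_pow n x).const_mul c
  have bound (ε : ℝ) (hε : |ε| = 1) :
      ε * (deriv (deriv p) (τ/3) - (2/τ) * ((p τ - p 0)/τ - deriv p 0)) ≤ τ ^ 2 * M / 36 := by
    have key := second_deriv_third_le_of_fourth_deriv_nonneg hτ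
      (f := fun s => M / 24 * s ^ 4 + ε * iteratedDeriv 0 p s)
      (f₁ := fun s => M / 6 * s ^ 3 + ε * iteratedDeriv 1 p s)
      (f₂ := fun s => M / 2 * s ^ 2 + ε * iteratedDeriv 2 p s)
      (f₃ := fun s => M * s ^ 1 + ε * iteratedDeriv 3 p s)
      (f₄ := fun s => M + ε * iteratedDeriv 4 p s)
      (fun x => ((hpow 4 _ x).add ((hderiv 0 (by norm_num) x).const_mul ε)).congr_deriv
        (by norm_num; ring))
      (fun x => ((hpow 3 _ x).add ((hderiv 1 (by norm_num) x).const_mul ε)).congr_deriv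
        (by norm_num; ring))
      (fun x => ((hpow 2 _ x).add ((hderiv 2 (by norm_num) x).const_mul ε)).congr_deriv
        (by norm_num; ring))
      (fun x => ((hpow 1 _ x).add ((hderiv 3 (by norm_num) x).const_mul ε)).congr_deriv
        (by norm_num))
      (fun x hx => by
        have h := neg_abs_le (ε * iteratedDeriv 4 p x)
        rw [abs_mul, hε, one_mul] at h
        linarith [hM x hx])
    have h2 : iteratedDeriv 2 p = deriv (deriv p) := by
      rw [iteratedDeriv_succ, iteratedDeriv_one]
    simp only [iteratedDeriv_zero, iteratedDeriv_one, h2] at key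
    have e : (2 / τ) * ((M / 24 * τ ^ 4 + ε * p τ - (M / 24 * 0 ^ 4 + ε * p 0)) / τ
        - (M / 6 * 0 ^ 3 + ε * deriv p 0))
        = M * τ ^ 2 / 12 + ε * ((2/τ) * ((p τ - p 0)/τ - deriv p 0)) := by
      field_simp
      ring
    rw [e] at key
    linarith
  have hle : τ ^ 2 * M / 36 ≤ (29/972) * τ ^ 2 * M := by
    linarith [mul_nonneg (sq_nonneg τ) hM0]
  rw [abs_le]
  constructor
  · linarith [bound (-1) (by norm_num)]
  · linarith [bound 1 (by norm_num)]
end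

section
/- Let α ∈ (1,2), σ = 1 - α/2, τ > 0, let k ≥ 1 be an integer, and let p : ℝ → ℝ be four times continuously differentiable on [(k-1)τ, (k+1)τ]. Then |∫_{t_{k-1/2}}^{t_{k+σ}} (p''(s) − δ_t² p^k)(t_{k+σ} - s)^{1-α} ds| ≤ (5 (σ + 1/2)^{2-α} / (24(2-α))) · max_{t_{k-1} ≤ s ≤ t_{k+1}} |p⁗(s)| · τ^{4-α}. -/
open MeasureTheory

/-- A primitive vanishing at `0` of a function bounded by `C * x ^ n` on `[0, h]` is bounded there
by `C / (n + 1) * x ^ (n + 1)`. -/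
lemma abs_le_mul_pow_succ_of_abs_deriv_le {f f' : ℝ → ℝ} {C h : ℝ} (n : ℕ)
    (hf : ∀ x, HasDerivAt f (f' x) x) (h0 : f 0 = 0)
    (hb : ∀ x ∈ Set.Icc 0 h, |f' x| ≤ C * x ^ n) :
    ∀ x ∈ Set.Icc 0 h, |f x| ≤ C / (n + 1) * x ^ (n + 1) := by
  have hB : ∀ x : ℝ, HasDerivAt (fun x => C / (n + 1) * x ^ (n + 1)) (C * x ^ n) x := by
    intro x
    have hn : (n : ℝ) + 1 ≠ 0 := by positivity
    refine HasDerivAt.congr_deriv ((hasDerivAt_pow (n + 1) x).const_mul (C / (n + 1))) ?_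
    rw [Nat.add_sub_cancel]
    push_cast
    field_simp
  intro x hx
  refine image_norm_le_of_norm_deriv_right_le_deriv_boundary' (f' := f')
    (B := fun x => C / (n + 1) * x ^ (n + 1)) (B' := fun x => C * x ^ n)
    (fun y _ => (hf y).continuousAt.continuousWithinAt)
    (fun y _ => (hf y).hasDerivWithinAt) ?_
    (fun y _ => (hB y).continuousAt.continuousWithinAt)
    (fun y _ => (hB y).hasDerivWithinAt)
    (fun y hy => hb y ⟨hy.1, hy.2.le⟩) hx
  simp [h0]

/-- First-order Taylor estimate along the direction `e`, where `e ^ 2 = 1`. -/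
lemma abs_taylor_one_le {f f₁ f₂ : ℝ → ℝ} {a h M e : ℝ} (he : e ^ 2 = 1)
    (hf : ∀ x, HasDerivAt f (f₁ x) x) (hf₁ : ∀ x, HasDerivAt f₁ (f₂ x) x)
    (hM : ∀ x ∈ Set.Icc 0 h, |f₂ (a + e * x)| ≤ M) :
    ∀ x ∈ Set.Icc 0 h, |f (a + e * x) - f a - f₁ a * (e * x)| ≤ M / 2 * x ^ 2 := by
  have hlin : ∀ x : ℝ, HasDerivAt (fun x => a + e * x) e x := fun x => by
    simpa using ((hasDerivAt_id x).const_mul e).const_add a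
  have hd₁ : ∀ x, HasDerivAt (fun x => e * (f₁ (a + e * x) - f₁ a)) (f₂ (a + e * x)) x := by
    intro x
    refine HasDerivAt.congr_deriv
      ((((hf₁ (a + e * x)).comp x (hlin x)).sub_const (f₁ a)).const_mul e) ?_
    linear_combination f₂ (a + e * x) * he
  have hd : ∀ x, HasDerivAt (fun x => f (a + e * x) - f a - f₁ a * (e * x))
      (e * (f₁ (a + e * x) - f₁ a)) x := by
    intro x
    refine HasDerivAt.congr_deriv ((((hf (a + e * x)).comp x (hlin x)).sub_const (f a)).sub
      (((hasDerivAt_id x).const_mul e).const_mul (f₁ a))) ?_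
    simp only [mul_one]
    ring
  have h₁ := abs_le_mul_pow_succ_of_abs_deriv_le (C := M) (h := h) 0 hd₁ (by simp)
    (by simpa using hM)
  have h₂ := abs_le_mul_pow_succ_of_abs_deriv_le _ hd (by simp) h₁
  intro x hx
  convert h₂ x hx using 2
  push_cast
  ring

/-- The symmetric second difference approximates the second derivative to fourth order. -/
lemma abs_symm_second_diff_sub_le {f f₁ f₂ f₃ f₄ : ℝ → ℝ} {a h M : ℝ}
    (hf : ∀ x, HasDerivAt f (f₁ x) x) (hf₁ : ∀ x, HasDerivAt f₁ (f₂ x) x)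
    (hf₂ : ∀ x, HasDerivAt f₂ (f₃ x) x) (hf₃ : ∀ x, HasDerivAt f₃ (f₄ x) x)
    (hM : ∀ x ∈ Set.Icc (a - h) (a + h), |f₄ x| ≤ M) :
    ∀ x ∈ Set.Icc 0 h,
      |f (a + x) + f (a - x) - 2 * f a - f₂ a * x ^ 2| ≤ M / 12 * x ^ 4 := by
  have hadd : ∀ {g g' : ℝ → ℝ}, (∀ x, HasDerivAt g (g' x) x) →
      ∀ x, HasDerivAt (fun x => g (a + x)) (g' (a + x)) x :=
    fun hg x => (hg (a + x)).comp_const_add a x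
  have hsub : ∀ {g g' : ℝ → ℝ}, (∀ x, HasDerivAt g (g' x) x) →
      ∀ x, HasDerivAt (fun x => g (a - x)) (-g' (a - x)) x :=
    fun hg x => (hg (a - x)).comp_const_sub a x
  have hd₃ : ∀ x, HasDerivAt (fun x => f₃ (a + x) - f₃ (a - x)) (f₄ (a + x) + f₄ (a - x)) x := by
    intro x
    refine HasDerivAt.congr_deriv ((hadd hf₃ x).sub (hsub hf₃ x)) ?_
    ring
  have hd₂ : ∀ x, HasDerivAt (fun x => f₂ (a + x) + f₂ (a - x) - 2 * f₂ a)
      (f₃ (a + x) - f₃ (a - x)) x := by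
    intro x
    refine HasDerivAt.congr_deriv (((hadd hf₂ x).add (hsub hf₂ x)).sub_const (2 * f₂ a)) ?_
    ring
  have hd₁ : ∀ x, HasDerivAt (fun x => f₁ (a + x) - f₁ (a - x) - 2 * f₂ a * x)
      (f₂ (a + x) + f₂ (a - x) - 2 * f₂ a) x := by
    intro x
    refine HasDerivAt.congr_deriv
      (((hadd hf₁ x).sub (hsub hf₁ x)).sub ((hasDerivAt_id x).const_mul (2 * f₂ a))) ?_
    ring
  have hd : ∀ x, HasDerivAt (fun x => f (a + x) + f (a - x) - 2 * f a - f₂ a * x ^ 2)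
      (f₁ (a + x) - f₁ (a - x) - 2 * f₂ a * x) x := by
    intro x
    refine HasDerivAt.congr_deriv ((((hadd hf x).add (hsub hf x)).sub_const (2 * f a)).sub
      ((hasDerivAt_pow 2 x).const_mul (f₂ a))) ?_
    push_cast
    ring
  have h₄ : ∀ x ∈ Set.Icc 0 h, |f₄ (a + x) + f₄ (a - x)| ≤ 2 * M * x ^ 0 := by
    intro x hx
    have h₁ := hM (a + x) ⟨by linarith [hx.1, hx.2], by linarith [hx.1, hx.2]⟩
    have h₂ := hM (a - x) ⟨by linarith [hx.1, hx.2], by linarith [hx.1, hx.2]⟩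
    linarith [abs_add_le (f₄ (a + x)) (f₄ (a - x))]
  have h₃ := abs_le_mul_pow_succ_of_abs_deriv_le _ hd₃ (by simp) h₄
  have h₂ := abs_le_mul_pow_succ_of_abs_deriv_le _ hd₂ (by simp; ring) h₃
  have h₁ := abs_le_mul_pow_succ_of_abs_deriv_le _ hd₁ (by simp) h₂
  have h₀ := abs_le_mul_pow_succ_of_abs_deriv_le _ hd (by simp; ring) h₁
  intro x hx
  convert h₀ x hx using 2
  push_cast
  ring

lemma intervalIntegrable_sub_rpow {a b r : ℝ} (hr : -1 < r) :
    IntervalIntegrable (fun s => (b - s) ^ r) volume a b := by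
  simpa using (intervalIntegral.intervalIntegrable_rpow' (a := b - a) (b := 0) hr).comp_sub_left b

lemma integral_sub_rpow {a b r : ℝ} (hr : -1 < r) :
    ∫ s in a..b, (b - s) ^ r = (b - a) ^ (r + 1) / (r + 1) := by
  rw [intervalIntegral.integral_comp_sub_left (fun u => u ^ r) b, integral_rpow (Or.inl hr),
    sub_self, Real.zero_rpow (by linarith), sub_zero]

/-- The choice of the collocation point `b` makes the linear moment of the kernel vanish. -/
lemma integral_linear_mul_sub_rpow_eq_zero {a b c r : ℝ} (hr : -1 < r) (hab : a ≤ b)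
    (hc : (b - c) * (r + 2) = (b - a) * (r + 1)) :
    ∫ s in a..b, (s - c) * (b - s) ^ r = 0 := by
  have hcongr : ∀ s ∈ Set.uIcc a b,
      (s - c) * (b - s) ^ r = (b - c) * (b - s) ^ r - (b - s) ^ (r + 1) := by
    intro s hs
    rw [Set.uIcc_of_le hab] at hs
    rw [Real.rpow_add_one' (sub_nonneg.2 hs.2) (by linarith)]
    ring
  rw [intervalIntegral.integral_congr hcongr, intervalIntegral.integral_sub
    ((intervalIntegrable_sub_rpow hr).const_mul _) (intervalIntegrable_sub_rpow (by linarith)),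
    intervalIntegral.integral_const_mul, integral_sub_rpow hr, integral_sub_rpow (by linarith),
    Real.rpow_add_one' (sub_nonneg.2 hab) (by linarith : r + 1 + 1 ≠ 0)]
  have h₁ : r + 1 ≠ 0 := by linarith
  have h₂ : r + 1 + 1 ≠ 0 := by linarith
  field_simp
  linear_combination (b - a) ^ (r + 1) * hc

/-- Estimate of the last-cell contribution to the truncation error:
`|∫_{t_{k-1/2}}^{t_{k+σ}} (p''(s) - δ_t² p^k)(t_{k+σ}-s)^{1-α} ds|
  ≤ (5(σ+1/2)^{2-α}/(24(2-α))) max_{[t_{k-1}, t_{k+1}]} |p⁗| τ^{4-α}`,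
with `σ = 1 - α/2`. -/
theorem last_cell_error (α τ : ℝ) (hα1 : 1 < α) (hα2 : α < 2) (hτ : 0 < τ)
    (k : ℕ) (hk : 1 ≤ k) (p : ℝ → ℝ) (hp : ContDiff ℝ 4 p) :
    |∫ s in (((k : ℝ) - 1/2) * τ)..(((k : ℝ) + (1 - α/2)) * τ),
        (deriv (deriv p) s - dt2 τ p k) * ((((k : ℝ) + (1 - α/2)) * τ) - s) ^ (1 - α)|
    ≤ (5 * ((1 - α/2) + 1/2) ^ (2 - α) / (24 * (2 - α))) *
        sSup ((fun s => |iteratedDeriv 4 p s|) ''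
          Set.Icc (((k : ℝ) - 1) * τ) (((k : ℝ) + 1) * τ)) *
        τ ^ (4 - α) := by
  have hd : ∀ n : ℕ, n < 4 → ∀ x, HasDerivAt (iteratedDeriv n p) (iteratedDeriv (n + 1) p x) x := by
    intro n hn x
    rw [iteratedDeriv_succ]
    exact (hp.differentiable_iteratedDeriv n (by exact_mod_cast hn) x).hasDerivAt
  have h2 : deriv (deriv p) = iteratedDeriv 2 p := by
    rw [iteratedDeriv_succ, iteratedDeriv_one]
  have hd0 : ∀ x, HasDerivAt p (iteratedDeriv 1 p x) x := by
    simpa only [iteratedDeriv_zero] using hd 0 (by norm_num)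
  rw [h2]
  set M := sSup ((fun s => |iteratedDeriv 4 p s|) ''
    Set.Icc (((k : ℝ) - 1) * τ) (((k : ℝ) + 1) * τ)) with hMdef
  have hM : ∀ x ∈ Set.Icc (k * τ - τ) (k * τ + τ), |iteratedDeriv 4 p x| ≤ M := by
    intro x hx
    refine le_csSup (isCompact_Icc.image (hp.continuous_iteratedDeriv 4 le_rfl).abs).bddAbove
      ⟨x, ⟨by linarith [hx.1], by linarith [hx.2]⟩, rfl⟩
  have hM0 : 0 ≤ M :=
    (abs_nonneg _).trans (hM (k * τ) ⟨by linarith, by linarith⟩)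
  have hdiff : |dt2 τ p k - iteratedDeriv 2 p (k * τ)| ≤ M / 12 * τ ^ 2 := by
    have h := abs_symm_second_diff_sub_le hd0 (hd 1 (by norm_num)) (hd 2 (by norm_num))
      (hd 3 (by norm_num)) hM τ ⟨hτ.le, le_rfl⟩
    have heq : dt2 τ p k - iteratedDeriv 2 p (k * τ) =
        (p (k * τ + τ) + p (k * τ - τ) - 2 * p (k * τ) - iteratedDeriv 2 p (k * τ) * τ ^ 2)
          / τ ^ 2 := by
      rw [dt2, if_neg (by omega), add_mul, sub_mul, one_mul]
      field_simp
      ring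
    rw [heq, abs_div, abs_of_pos (pow_pos hτ 2), div_le_iff₀ (pow_pos hτ 2)]
    linarith
  have htaylor : ∀ s, |s - k * τ| ≤ τ / 2 →
      |iteratedDeriv 2 p s - iteratedDeriv 2 p (k * τ) - iteratedDeriv 3 p (k * τ) * (s - k * τ)|
        ≤ M / 8 * τ ^ 2 := by
    intro s hs
    obtain ⟨e, he, hes⟩ : ∃ e : ℝ, e ^ 2 = 1 ∧ s - k * τ = e * |s - k * τ| := by
      rcases abs_choice (s - k * τ) with h | h
      · exact ⟨1, by norm_num, by rw [h, one_mul]⟩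
      · exact ⟨-1, by norm_num, by rw [h]; ring⟩
    have h := abs_taylor_one_le (a := k * τ) (h := τ) (M := M) he (hd 2 (by norm_num))
      (hd 3 (by norm_num)) ?_ |s - k * τ| ⟨abs_nonneg _, by linarith⟩
    · rw [← hes, add_sub_cancel] at h
      refine h.trans ?_
      have := pow_le_pow_left₀ (abs_nonneg _) hs 2
      nlinarith
    · intro x hx
      have habs : |e| = 1 := by
        rcases eq_or_eq_neg_of_sq_eq_sq e 1 (by rw [he, one_pow]) with rfl | rfl <;> simp
      have hex : |e * x| ≤ τ := by
        rw [abs_mul, habs, one_mul,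
          abs_of_nonneg hx.1]
        exact hx.2
      rw [abs_le] at hex
      exact hM _ ⟨by linarith [hex.1], by linarith [hex.2]⟩
  set a := ((k : ℝ) - 1/2) * τ with ha
  set b := ((k : ℝ) + (1 - α/2)) * τ with hb
  have hr : -1 < 1 - α := by linarith
  have hba : b - a = ((1 - α/2) + 1/2) * τ := by rw [ha, hb]; ring
  have hab : a ≤ b := by
    have : 0 ≤ ((1 - α/2) + 1/2) * τ := mul_nonneg (by linarith) hτ.le
    linarith
  have hker : IntervalIntegrable (fun s => (b - s) ^ (1 - α)) volume a b :=
    intervalIntegrable_sub_rpow hr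
  have hzero : ∫ s in a..b, (s - k * τ) * (b - s) ^ (1 - α) = 0 := by
    refine integral_linear_mul_sub_rpow_eq_zero hr hab ?_
    rw [hba, hb]
    ring
  have hcont : Continuous (iteratedDeriv 2 p) :=
    hp.continuous_iteratedDeriv 2 (by norm_num)
  have hint : IntervalIntegrable
      (fun s => (iteratedDeriv 2 p s - dt2 τ p k) * (b - s) ^ (1 - α)) volume a b :=
    hker.continuousOn_mul (by fun_prop)
  have hlin : IntervalIntegrable (fun s => (s - k * τ) * (b - s) ^ (1 - α)) volume a b :=
    hker.continuousOn_mul (by fun_prop)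
  have hremove : ∫ s in a..b, (iteratedDeriv 2 p s - dt2 τ p k) * (b - s) ^ (1 - α) =
      ∫ s in a..b, ((iteratedDeriv 2 p s - dt2 τ p k) * (b - s) ^ (1 - α) -
        iteratedDeriv 3 p (k * τ) * ((s - k * τ) * (b - s) ^ (1 - α))) := by
    rw [intervalIntegral.integral_sub hint (hlin.const_mul _),
      intervalIntegral.integral_const_mul, hzero, mul_zero, sub_zero]
  have hbound : ∀ s ∈ Set.Ioc a b,
      ‖(iteratedDeriv 2 p s - dt2 τ p k) * (b - s) ^ (1 - α) -
        iteratedDeriv 3 p (k * τ) * ((s - k * τ) * (b - s) ^ (1 - α))‖ ≤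
      5 / 24 * M * τ ^ 2 * (b - s) ^ (1 - α) := by
    intro s hs
    have hs' : |s - k * τ| ≤ τ / 2 := by
      have h₁ := hs.1
      have h₂ := hs.2
      rw [ha] at h₁
      rw [hb] at h₂
      rw [abs_le]
      constructor <;> nlinarith
    have hk0 : 0 ≤ (b - s) ^ (1 - α) := Real.rpow_nonneg (sub_nonneg.2 hs.2) _
    rw [show (iteratedDeriv 2 p s - dt2 τ p k) * (b - s) ^ (1 - α) -
        iteratedDeriv 3 p (k * τ) * ((s - k * τ) * (b - s) ^ (1 - α)) =
        ((iteratedDeriv 2 p s - iteratedDeriv 2 p (k * τ)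
          - iteratedDeriv 3 p (k * τ) * (s - k * τ))
          - (dt2 τ p k - iteratedDeriv 2 p (k * τ))) * (b - s) ^ (1 - α) by ring,
      norm_mul, Real.norm_of_nonneg hk0]
    refine mul_le_mul_of_nonneg_right ((norm_sub_le _ _).trans ?_) hk0
    rw [Real.norm_eq_abs, Real.norm_eq_abs]
    linarith [htaylor s hs']
  rw [hremove, ← Real.norm_eq_abs]
  refine (intervalIntegral.norm_integral_le_of_norm_le hab
    (Filter.Eventually.of_forall hbound) (hker.const_mul _)).trans_eq ?_
  rw [intervalIntegral.integral_const_mul, integral_sub_rpow hr, hba,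
    show 1 - α + 1 = 2 - α by ring, Real.mul_rpow (by linarith) hτ.le,
    show 4 - α = (2 - α) + (2 : ℕ) by push_cast; ring, Real.rpow_add_natCast hτ.ne']
  have : 2 - α ≠ 0 := by linarith
  field_simp
end

section
/- Let α ∈ (1,2), σ = 1 - α/2, τ > 0, and let k ≥ 1 be an integer. Then the H3N3-2σ coefficients satisfy the strict chain c₀^{(k,α)} > c₁^{(k,α)} > ⋯ > c_{k-1}^{(k,α)} > c_k^{(k,α)} > (3/8)(k + σ)^{1-α} τ^{2-α} > 0. -/
open MeasureTheory Finset

/-- `a_l^{(k,α)}` from the H3N3-2σ construction. -/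
noncomputable def aCoef (α σ τ : ℝ) (k l : ℕ) : ℝ :=
  if l = 1 then
    (3/2) * τ ^ (2 - α) * ∫ s in (0:ℝ)..(1/2), (s - 1/3) * ((k : ℝ) + σ - s) ^ (1 - α)
  else
    τ ^ (2 - α) * ∫ s in (0:ℝ)..1, (s - 1/2) * ((k : ℝ) + σ - (l : ℝ) + 3/2 - s) ^ (1 - α)

/-- `b_l^{(k,α)}` from the H3N3-2σ construction. -/
noncomputable def bCoef (α σ τ : ℝ) (k l : ℕ) : ℝ :=
  if l = k then
    τ ^ (2 - α) * ∫ s in (0:ℝ)..(σ + 1/2), s ^ (1 - α)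
  else
    τ ^ (2 - α) * ∫ s in (0:ℝ)..1, (3/2 - s) * ((k : ℝ) + σ - (l : ℝ) + 1/2 - s) ^ (1 - α)

/-- `c_l^{(k,α)}`, the H3N3-2σ coefficients. -/
noncomputable def cCoef (α σ τ : ℝ) (k l : ℕ) : ℝ :=
  if l = k then
    (3/2) * τ ^ (2 - α) * ∫ s in (0:ℝ)..(1/2), (1 - s) * ((k : ℝ) + σ - s) ^ (1 - α)
  else
    aCoef α σ τ k (k - l) + bCoef α σ τ k (k - l)

/-- The first moment of `s ↦ (x - s) ^ r` on `[0, 1]` about the midpoint. -/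
noncomputable def centeredMoment (r x : ℝ) : ℝ :=
  ∫ s in (0:ℝ)..1, (s - 1/2) * (x - s) ^ r

/-- The integral of `s ↦ (x - s) ^ r` on `[0, 1]` against the weight `3/2 - s`. -/
noncomputable def weightedMean (r x : ℝ) : ℝ :=
  ∫ s in (0:ℝ)..1, (3/2 - s) * (x - s) ^ r

lemma continuousOn_sub_rpow {b x : ℝ} (r : ℝ) (hx : b < x) :
    ContinuousOn (fun s : ℝ => (x - s) ^ r) (Set.Icc 0 b) := by
  refine ContinuousOn.rpow_const (by fun_prop) fun s hs => Or.inl ?_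
  linarith [hs.2]

lemma intervalIntegrable_mul_sub_rpow {b x : ℝ} (r : ℝ) (hb : 0 ≤ b) (hx : b < x)
    {w : ℝ → ℝ} (hw : Continuous w) :
    IntervalIntegrable (fun s => w s * (x - s) ^ r) volume 0 b :=
  (hw.continuousOn.mul (continuousOn_sub_rpow r hx)).intervalIntegrable_of_Icc hb

lemma integral_affine (p q b : ℝ) : ∫ s in (0:ℝ)..b, (p + q * s) = p * b + q * b ^ 2 / 2 := by
  rw [intervalIntegral.integral_add (by simp) (Continuous.intervalIntegrable (by fun_prop) _ _),
    intervalIntegral.integral_const_mul, integral_id, intervalIntegral.integral_const,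
    smul_eq_mul]
  ring

lemma integral_affine_mul_const (p q b c : ℝ) :
    ∫ s in (0:ℝ)..b, (p + q * s) * c = (p * b + q * b ^ 2 / 2) * c := by
  rw [intervalIntegral.integral_mul_const, integral_affine]

lemma antitoneOn_rpow_sub_rpow_add_one {r : ℝ} (hr : r ≤ 0) :
    AntitoneOn (fun u : ℝ => u ^ r - (u + 1) ^ r) (Set.Ioi 0) := by
  have hd : ∀ u ∈ Set.Ioi (0:ℝ), HasDerivAt (fun u : ℝ => u ^ r - (u + 1) ^ r)
      (r * u ^ (r - 1) - r * (u + 1) ^ (r - 1)) u := by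
    intro u hu
    have hu' : 0 < u := hu
    refine (Real.hasDerivAt_rpow_const (Or.inl hu'.ne')).sub ?_
    simpa using ((hasDerivAt_id u).add_const 1).rpow_const (p := r)
      (Or.inl (by simp only [id]; linarith))
  refine antitoneOn_of_deriv_nonpos (convex_Ioi 0)
    (fun u hu => (hd u hu).continuousAt.continuousWithinAt)
    (fun u hu => (hd u (interior_subset hu)).differentiableAt.differentiableWithinAt) ?_
  intro u hu
  have hu := interior_subset hu
  rw [(hd u hu).deriv]
  have : (u + 1) ^ (r - 1) ≤ u ^ (r - 1) :=
    Real.rpow_le_rpow_of_nonpos hu (by linarith) (by linarith)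
  nlinarith

lemma integral_centered_mul_nonneg {g : ℝ → ℝ} (hc : ContinuousOn g (Set.Icc 0 1))
    (hg : MonotoneOn g (Set.Icc 0 1)) : 0 ≤ ∫ s in (0:ℝ)..1, (s - 1/2) * g s := by
  have h0 : ∫ s in (0:ℝ)..1, (-(1/2) + 1 * s) * g (1/2) = 0 := by
    rw [integral_affine_mul_const]; ring
  have hw : ContinuousOn (fun s : ℝ => s - 1/2) (Set.Icc 0 1) := by fun_prop
  refine h0.symm.trans_le ?_
  refine intervalIntegral.integral_mono_on zero_le_one
    (Continuous.intervalIntegrable (by fun_prop) _ _)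
    ((hw.mul hc).intervalIntegrable_of_Icc zero_le_one) fun s hs => ?_
  have hm : (1/2 : ℝ) ∈ Set.Icc (0:ℝ) 1 := by norm_num
  rcases le_total s (1/2) with h | h
  · nlinarith [hg hs hm h]
  · nlinarith [hg hm hs h]

lemma centeredMoment_nonneg {r x : ℝ} (hr : r ≤ 0) (hx : 1 < x) : 0 ≤ centeredMoment r x := by
  refine integral_centered_mul_nonneg (continuousOn_sub_rpow r hx) fun s _ t ht hst => ?_
  exact Real.rpow_le_rpow_of_nonpos (by linarith [ht.2]) (by linarith) hr

lemma centeredMoment_add_one_le {r x : ℝ} (hr : r ≤ 0) (hx : 1 < x) :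
    centeredMoment r (x + 1) ≤ centeredMoment r x := by
  have hx1 : 1 < x + 1 := by linarith
  rw [← sub_nonneg, centeredMoment, centeredMoment, ← intervalIntegral.integral_sub
    (intervalIntegrable_mul_sub_rpow r zero_le_one hx (by fun_prop))
    (intervalIntegrable_mul_sub_rpow r zero_le_one hx1 (by fun_prop))]
  simp only [← mul_sub]
  refine integral_centered_mul_nonneg
    ((continuousOn_sub_rpow r hx).sub (continuousOn_sub_rpow r hx1)) fun s hs t ht hst => ?_
  have hxs : 0 < x - s := by linarith [hs.2]
  have hxt : 0 < x - t := by linarith [ht.2]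
  have h := antitoneOn_rpow_sub_rpow_add_one hr hxt hxs (by linarith)
  simpa only [sub_add_eq_add_sub] using h

lemma weightedMean_add_one_lt {r x : ℝ} (hr : r < 0) (hx : 0 < x) :
    weightedMean r (x + 1) < x ^ r := by
  have h1 : ∫ s in (0:ℝ)..1, (3/2 + -1 * s) * x ^ r = x ^ r := by
    rw [integral_affine_mul_const]; ring
  rw [← h1]
  refine intervalIntegral.integral_lt_integral_of_continuousOn_of_le_of_exists_lt zero_lt_one
    (ContinuousOn.mul (by fun_prop) (continuousOn_sub_rpow r (by linarith))) (by fun_prop) ?_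
    ⟨0, by norm_num, ?_⟩
  · intro s hs
    have := Real.rpow_le_rpow_of_nonpos hx (show x ≤ x + 1 - s by linarith [hs.2]) hr.le
    nlinarith [hs.2]
  · have := Real.rpow_lt_rpow_of_neg hx (show x < x + 1 - 0 by linarith) hr
    linarith

lemma rpow_le_weightedMean {r x : ℝ} (hr : r ≤ 0) (hx : 1 < x) : x ^ r ≤ weightedMean r x := by
  have h1 : ∫ s in (0:ℝ)..1, (3/2 + -1 * s) * x ^ r = x ^ r := by
    rw [integral_affine_mul_const]; ring
  rw [← h1]
  refine intervalIntegral.integral_mono_on zero_le_one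
    (Continuous.intervalIntegrable (by fun_prop) _ _)
    (intervalIntegrable_mul_sub_rpow r zero_le_one hx (by fun_prop)) fun s hs => ?_
  have := Real.rpow_le_rpow_of_nonpos (show 0 < x - s by linarith [hs.2])
    (show x - s ≤ x by linarith [hs.1]) hr
  nlinarith [hs.2]

lemma rpow_lt_integral_rpow {r : ℝ} (hr : -1 < r) (hr0 : r < 0) :
    ((1 + r) / 2 + 1/2) ^ r < ∫ s in (0:ℝ)..((1 + r) / 2 + 1/2), s ^ r := by
  have hy : 0 < (1 + r) / 2 + 1/2 := by linarith
  have hp := Real.rpow_pos_of_pos hy r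
  rw [integral_rpow (Or.inl hr), Real.zero_rpow (by linarith), sub_zero,
    Real.rpow_add_one hy.ne', lt_div_iff₀ (by linarith)]
  nlinarith

lemma rpow_sub_half_le {r x : ℝ} (hr : -1 ≤ r) (hx : 2 ≤ x) :
    (x - 1/2) ^ r ≤ 4/3 * x ^ r := by
  have h : (x - 1/2) ^ (r + 1) ≤ x ^ (r + 1) :=
    Real.rpow_le_rpow (by linarith) (by linarith) (by linarith)
  rw [Real.rpow_add_one (by linarith), Real.rpow_add_one (by linarith)] at h
  nlinarith [Real.rpow_nonneg (show 0 ≤ x by linarith) r]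

lemma integral_sub_third_mul_neg {r x : ℝ} (hr : -1 ≤ r) (hr0 : r ≤ 0) (hx : 2 ≤ x) :
    ∫ s in (0:ℝ)..(1/2), (s - 1/3) * (x - s) ^ r < 0 := by
  have hp : 0 < x ^ r := Real.rpow_pos_of_pos (by linarith) r
  have hM := rpow_sub_half_le hr hx
  have key : ∫ s in (0:ℝ)..(1/2), (s - 1/3) * (x - s) ^ r ≤
      ∫ s in (0:ℝ)..(1/2), (-(1/3) + 10/9 * s) * x ^ r := by
    refine intervalIntegral.integral_mono_on (by norm_num)
      (intervalIntegrable_mul_sub_rpow r (by norm_num) (by linarith) (by fun_prop))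
      (Continuous.intervalIntegrable (by fun_prop) _ _) fun s hs => ?_
    have hlo := Real.rpow_le_rpow_of_nonpos (show 0 < x - s by linarith [hs.2])
      (show x - s ≤ x by linarith [hs.1]) hr0
    have hhi := Real.rpow_le_rpow_of_nonpos (show 0 < x - 1/2 by linarith)
      (show x - 1/2 ≤ x - s by linarith [hs.2]) hr0
    rcases le_total s (1/3) with h | h
    · calc (s - 1/3) * (x - s) ^ r ≤ (s - 1/3) * x ^ r :=
            mul_le_mul_of_nonpos_left hlo (by linarith)
        _ ≤ _ := by gcongr; linarith [hs.1]
    · calc (s - 1/3) * (x - s) ^ r ≤ (s - 1/3) * (4/3 * x ^ r) :=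
            mul_le_mul_of_nonneg_left (hhi.trans hM) (by linarith)
        _ = (s - 1/3) * (4/3) * x ^ r := by ring
        _ ≤ _ := by gcongr; linarith [hs.2]
  rw [integral_affine_mul_const] at key
  linarith

lemma integral_one_sub_sub_integral_sub_third_lt {r x : ℝ} (hr : r ≤ 0) (hx : 1/2 < x) :
    3/2 * (∫ s in (0:ℝ)..(1/2), (1 - s) * (x - s) ^ r) -
      3/2 * (∫ s in (0:ℝ)..(1/2), (s - 1/3) * (x - s) ^ r) < (x - 1/2) ^ r := by
  have hp : 0 < (x - 1/2) ^ r := Real.rpow_pos_of_pos (by linarith) r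
  rw [← mul_sub, ← intervalIntegral.integral_sub
    (intervalIntegrable_mul_sub_rpow r (by norm_num) hx (by fun_prop))
    (intervalIntegrable_mul_sub_rpow r (by norm_num) hx (by fun_prop))]
  simp only [← sub_mul]
  have key : ∫ s in (0:ℝ)..(1/2), (1 - s - (s - 1/3)) * (x - s) ^ r ≤
      ∫ s in (0:ℝ)..(1/2), (4/3 + -2 * s) * (x - 1/2) ^ r := by
    refine intervalIntegral.integral_mono_on (by norm_num)
      (intervalIntegrable_mul_sub_rpow r (by norm_num) hx (by fun_prop))
      (Continuous.intervalIntegrable (by fun_prop) _ _) fun s hs => ?_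
    have h := Real.rpow_le_rpow_of_nonpos (show 0 < x - 1/2 by linarith)
      (show x - 1/2 ≤ x - s by linarith [hs.2]) hr
    nlinarith [hs.2]
  rw [integral_affine_mul_const] at key
  linarith

lemma rpow_lt_integral_one_sub {r x : ℝ} (hr : r ≤ 0) (hx : 1/2 < x) :
    3/8 * x ^ r < 3/2 * ∫ s in (0:ℝ)..(1/2), (1 - s) * (x - s) ^ r := by
  have hp : 0 < x ^ r := Real.rpow_pos_of_pos (by linarith) r
  have key : ∫ s in (0:ℝ)..(1/2), (1 + -1 * s) * x ^ r ≤
      ∫ s in (0:ℝ)..(1/2), (1 - s) * (x - s) ^ r := by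
    refine intervalIntegral.integral_mono_on (by norm_num)
      (Continuous.intervalIntegrable (by fun_prop) _ _)
      (intervalIntegrable_mul_sub_rpow r (by norm_num) hx (by fun_prop)) fun s hs => ?_
    have h := Real.rpow_le_rpow_of_nonpos (show 0 < x - s by linarith [hs.2])
      (show x - s ≤ x by linarith [hs.1]) hr
    nlinarith [hs.2]
  rw [integral_affine_mul_const] at key
  linarith

lemma aCoef_one (α σ τ : ℝ) (k : ℕ) : aCoef α σ τ k 1 = τ ^ (2 - α) *
    (3/2 * ∫ s in (0:ℝ)..(1/2), (s - 1/3) * ((k : ℝ) + σ - s) ^ (1 - α)) := by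
  rw [aCoef, if_pos rfl]; ring

lemma aCoef_sub {k l : ℕ} (α σ τ : ℝ) (h : l + 1 < k) :
    aCoef α σ τ k (k - l) = τ ^ (2 - α) * centeredMoment (1 - α) (l + σ + 3/2) := by
  rw [aCoef, if_neg (by omega), centeredMoment, Nat.cast_sub (by omega)]
  simp only [show (k : ℝ) + σ - (k - l) + 3/2 = l + σ + 3/2 by ring]

lemma bCoef_sub {k l : ℕ} (α σ τ : ℝ) (h0 : 0 < l) (h : l ≤ k) :
    bCoef α σ τ k (k - l) = τ ^ (2 - α) * weightedMean (1 - α) (l + σ + 1/2) := by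
  rw [bCoef, if_neg (by omega), weightedMean, Nat.cast_sub h]
  simp only [show (k : ℝ) + σ - (k - l) + 1/2 = l + σ + 1/2 by ring]

lemma rpow_le_bCoef {k l : ℕ} {α τ : ℝ} (hα1 : 1 < α) (hα2 : α < 2) (hτ : 0 < τ) (h : l ≤ k) :
    τ ^ (2 - α) * (l + (1 - α/2) + 1/2) ^ (1 - α) ≤ bCoef α (1 - α/2) τ k (k - l) := by
  rcases l.eq_zero_or_pos with rfl | h0
  · rw [bCoef, Nat.sub_zero, if_pos rfl]
    have := rpow_lt_integral_rpow (r := 1 - α) (by linarith) (by linarith)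
    rw [show (1 + (1 - α)) / 2 = 1 - α/2 by ring] at this
    rw [Nat.cast_zero, zero_add]
    gcongr
  · rw [bCoef_sub _ _ _ h0 h]
    have : (1:ℝ) ≤ l := by exact_mod_cast h0
    gcongr
    exact rpow_le_weightedMean (by linarith) (by linarith)

lemma bCoef_sub_succ_lt {k l : ℕ} {α τ : ℝ} (hα1 : 1 < α) (hα2 : α < 2) (hτ : 0 < τ)
    (h : l + 1 ≤ k) :
    bCoef α (1 - α/2) τ k (k - (l + 1)) < bCoef α (1 - α/2) τ k (k - l) := by
  refine lt_of_lt_of_le ?_ (rpow_le_bCoef hα1 hα2 hτ (by omega))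
  rw [bCoef_sub _ _ _ l.succ_pos h, Nat.cast_add_one,
    show (l:ℝ) + 1 + (1 - α/2) + 1/2 = l + (1 - α/2) + 1/2 + 1 by ring]
  have := weightedMean_add_one_lt (r := 1 - α) (x := l + (1 - α/2) + 1/2) (by linarith)
    (by linarith [l.cast_nonneg (α := ℝ)])
  gcongr

lemma aCoef_sub_succ_le {k l : ℕ} {α τ : ℝ} (hα1 : 1 < α) (hα2 : α < 2) (hτ : 0 < τ)
    (h : l + 1 < k) :
    aCoef α (1 - α/2) τ k (k - (l + 1)) ≤ aCoef α (1 - α/2) τ k (k - l) := by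
  have hl := l.cast_nonneg (α := ℝ)
  rw [aCoef_sub _ _ _ h]
  rcases (show l + 2 ≤ k by omega).eq_or_lt with rfl | h2
  · rw [show l + 2 - (l + 1) = 1 by omega, aCoef_one]
    have h1 := integral_sub_third_mul_neg (r := 1 - α) (x := (l + 2 : ℕ) + (1 - α/2))
      (by linarith) (by linarith) (by push_cast; linarith)
    have h2 := centeredMoment_nonneg (r := 1 - α) (x := l + (1 - α/2) + 3/2)
      (by linarith) (by linarith)
    gcongr
    linarith
  · rw [aCoef_sub _ _ _ h2, Nat.cast_add_one,
      show (l:ℝ) + 1 + (1 - α/2) + 3/2 = l + (1 - α/2) + 3/2 + 1 by ring]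
    gcongr
    exact centeredMoment_add_one_le (by linarith) (by linarith)

lemma cCoef_self (α σ τ : ℝ) (k : ℕ) : cCoef α σ τ k k = τ ^ (2 - α) *
    (3/2 * ∫ s in (0:ℝ)..(1/2), (1 - s) * ((k : ℝ) + σ - s) ^ (1 - α)) := by
  rw [cCoef, if_pos rfl]; ring

lemma cCoef_succ_self_lt {l : ℕ} {α τ : ℝ} (hα1 : 1 < α) (hα2 : α < 2) (hτ : 0 < τ) :
    cCoef α (1 - α/2) τ (l + 1) (l + 1) < cCoef α (1 - α/2) τ (l + 1) l := by
  have hl := l.cast_nonneg (α := ℝ)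
  have hb := rpow_le_bCoef hα1 hα2 hτ l.le_succ
  rw [cCoef_self, cCoef, if_neg (by omega)]
  rw [Nat.succ_eq_add_one, Nat.add_sub_cancel_left] at *
  rw [aCoef_one]
  have h := integral_one_sub_sub_integral_sub_third_lt (r := 1 - α)
    (x := (l + 1 : ℕ) + (1 - α/2)) (by linarith) (by push_cast; linarith)
  rw [show ((l + 1 : ℕ) : ℝ) + (1 - α/2) - 1/2 = l + (1 - α/2) + 1/2 by push_cast; ring] at h
  have := mul_lt_mul_of_pos_left h (Real.rpow_pos_of_pos hτ (2 - α))
  rw [mul_sub] at this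
  linarith

/-- Lemma 2.1, inequality (2.10): the H3N3-2σ coefficients are strictly
decreasing and bounded below:
`c₀ > c₁ > ⋯ > c_k > (3/8)(k+σ)^{1-α} τ^{2-α} > 0` with `σ = 1 - α/2`. -/
theorem cCoef_strict_decreasing_pos (α τ : ℝ) (hα1 : 1 < α) (hα2 : α < 2)
    (hτ : 0 < τ) (k : ℕ) (hk : 1 ≤ k) :
    (∀ l < k, cCoef α (1 - α/2) τ k (l+1) < cCoef α (1 - α/2) τ k l) ∧
    (3/8) * ((k : ℝ) + (1 - α/2)) ^ (1 - α) * τ ^ (2 - α) < cCoef α (1 - α/2) τ k k ∧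
    0 < (3/8) * ((k : ℝ) + (1 - α/2)) ^ (1 - α) * τ ^ (2 - α) := by
  have hk' : (1:ℝ) ≤ k := by exact_mod_cast hk
  have hT : 0 < τ ^ (2 - α) := Real.rpow_pos_of_pos hτ _
  refine ⟨fun l hl => ?_, ?_, ?_⟩
  · rcases (show l + 1 ≤ k from hl).eq_or_lt with rfl | h
    · exact cCoef_succ_self_lt hα1 hα2 hτ
    · rw [cCoef, if_neg h.ne, cCoef, if_neg hl.ne]
      exact add_lt_add_of_le_of_lt (aCoef_sub_succ_le hα1 hα2 hτ h)
        (bCoef_sub_succ_lt hα1 hα2 hτ h.le)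
  · have := rpow_lt_integral_one_sub (r := 1 - α) (x := k + (1 - α/2)) (by linarith)
      (by linarith)
    rw [cCoef_self, mul_comm]
    gcongr
  · have := Real.rpow_pos_of_pos (show 0 < (k:ℝ) + (1 - α/2) by linarith) (1 - α)
    positivity
end

section
/- Let α ∈ (1,2), σ = 1 - α/2, τ > 0, and let k ≥ 1 be an integer. Then the last H3N3-2σ coefficient satisfies the explicit identity c_k^{(k,α)} = (3 τ^{2-α} / (2(1 + 2σ)(2 - α))) · [ (k - 1)(k + σ - 1/2)^{2-α} − (k - 1 - σ)(k + σ)^{2-α} ]. -/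
open MeasureTheory Finset

/-- Integral of a shifted power against the weight `1 - s`, away from the singularity `s = x`. -/
lemma integral_one_sub_mul_sub_rpow {p x b : ℝ} (hp : 0 < p) (hb : 0 ≤ b) (hbx : b < x) :
    ∫ s in (0:ℝ)..b, (1 - s) * (x - s) ^ (p - 1) =
      ((p + 1 - x) * x ^ p - (p + 1 - x - p * b) * (x - b) ^ p) / (p * (p + 1)) := by
  have hpos : ∀ s ∈ Set.uIcc 0 b, 0 < x - s := fun s hs => by
    rw [Set.uIcc_of_le hb] at hs
    linarith [hs.2]
  have hderiv : ∀ s ∈ Set.uIcc 0 b,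
      HasDerivAt (fun s => -((p + 1 - x - p * s) * (x - s) ^ p) / (p * (p + 1)))
        ((1 - s) * (x - s) ^ (p - 1)) s := fun s hs => by
    have hs0 := hpos s hs
    have hpow := ((hasDerivAt_id' s).const_sub x).rpow_const (p := p) (Or.inl hs0.ne')
    have hlin := ((hasDerivAt_id' s).const_mul p).const_sub (p + 1 - x)
    refine ((hlin.mul hpow).neg.div_const (p * (p + 1))).congr_deriv ?_
    have hsplit : (x - s) ^ p = (x - s) ^ (p - 1) * (x - s) := by
      rw [Real.rpow_sub_one hs0.ne', div_mul_cancel₀ _ hs0.ne']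
    rw [hsplit]
    field_simp
    ring
  have hcont : ContinuousOn (fun s => (1 - s) * (x - s) ^ (p - 1)) (Set.uIcc 0 b) :=
    (by fun_prop : Continuous fun s : ℝ => 1 - s).continuousOn.mul
      ((by fun_prop : Continuous fun s : ℝ => x - s).continuousOn.rpow_const
        fun s hs => Or.inl (hpos s hs).ne')
  rw [intervalIntegral.integral_eq_sub_of_hasDerivAt hderiv hcont.intervalIntegrable]
  simp only [mul_zero, sub_zero]
  ring

/-- Closed-form identity for the last H3N3-2σ coefficient:
`c_k^{(k,α)} = (3τ^{2-α}/(2(1+2σ)(2-α)))[(k-1)(k+σ-1/2)^{2-α} - (k-1-σ)(k+σ)^{2-α}]`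
with `σ = 1 - α/2`. -/
theorem cCoef_last_closed_form (α τ : ℝ) (hα1 : 1 < α) (hα2 : α < 2)
    (hτ : 0 < τ) (k : ℕ) (hk : 1 ≤ k) :
    cCoef α (1 - α/2) τ k k =
      (3 * τ ^ (2 - α) / (2 * (1 + 2 * (1 - α/2)) * (2 - α))) *
        (((k : ℝ) - 1) * ((k : ℝ) + (1 - α/2) - 1/2) ^ (2 - α) -
         ((k : ℝ) - 1 - (1 - α/2)) * ((k : ℝ) + (1 - α/2)) ^ (2 - α)) := by
  have hk' : (1 : ℝ) ≤ k := by exact_mod_cast hk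
  have hp : 0 < 2 - α := by linarith
  have key := integral_one_sub_mul_sub_rpow (x := (k : ℝ) + (1 - α / 2)) (b := 1 / 2) hp
    (by norm_num) (by linarith)
  rw [show 2 - α - 1 = 1 - α by ring] at key
  rw [cCoef, if_pos rfl, key]
  have h3 : 2 - α + 1 ≠ 0 := by linarith
  rw [show 1 + 2 * (1 - α / 2) = 2 - α + 1 by ring]
  field_simp
  ring
end

section
/- Let α ∈ (1,2), σ = 1 - α/2, and τ > 0. Then c₀^{(1,α)} − c₁^{(1,α)} = (1 - σ)(1 + σ)^{2-α} τ^{2-α} / ((2 - α)(3 - α)); in particular c₀^{(1,α)} > c₁^{(1,α)}. -/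
open MeasureTheory Finset

theorem integral_affine_mul_sub_rpow {X h p : ℝ} (m n : ℝ) (hX : 0 < X) (hh : h < X)
    (hp : -1 < p) :
    ∫ s in (0:ℝ)..h, (m + n * s) * (X - s) ^ p =
      (m + n * X) * ((X ^ (p + 1) - (X - h) ^ (p + 1)) / (p + 1)) -
        n * ((X ^ (p + 2) - (X - h) ^ (p + 2)) / (p + 2)) := by
  have hpos : ∀ u ∈ Set.uIcc (X - h) X, 0 < u := fun u hu =>
    (lt_inf_iff.2 ⟨sub_pos.2 hh, hX⟩).trans_le hu.1
  have hsub : ∫ s in (0:ℝ)..h, (m + n * s) * (X - s) ^ p =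
      ∫ u in (X - h)..X, (m + n * (X - u)) * u ^ p := by
    simpa using
      intervalIntegral.integral_comp_sub_left (a := 0) (b := h)
        (fun u => (m + n * (X - u)) * u ^ p) X
  have hsplit : ∫ u in (X - h)..X, (m + n * (X - u)) * u ^ p =
      ∫ u in (X - h)..X, ((m + n * X) * u ^ p - n * u ^ (p + 1)) := by
    refine intervalIntegral.integral_congr fun u hu => ?_
    simp only [Real.rpow_add_one (hpos u hu).ne']
    ring
  rw [hsub, hsplit, intervalIntegral.integral_sub, intervalIntegral.integral_const_mul,
    intervalIntegral.integral_const_mul, integral_rpow (Or.inl hp),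
    integral_rpow (Or.inl (by linarith)), show p + 1 + 1 = p + 2 by ring]
  · exact (intervalIntegral.intervalIntegrable_rpow' hp).const_mul _
  · exact (intervalIntegral.intervalIntegrable_rpow' (by linarith)).const_mul _

/-- For `k = 1`:
`c₀^{(1,α)} - c₁^{(1,α)} = (1-σ)(1+σ)^{2-α} τ^{2-α} / ((2-α)(3-α)) > 0`
with `σ = 1 - α/2`; in particular `c₀^{(1,α)} > c₁^{(1,α)}`. -/
theorem cCoef_k1_difference (α τ : ℝ) (hα1 : 1 < α) (hα2 : α < 2) (hτ : 0 < τ) :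
    cCoef α (1 - α/2) τ 1 0 - cCoef α (1 - α/2) τ 1 1 =
      (1 - (1 - α/2)) * (1 + (1 - α/2)) ^ (2 - α) * τ ^ (2 - α) /
        ((2 - α) * (3 - α)) ∧
    cCoef α (1 - α/2) τ 1 1 < cCoef α (1 - α/2) τ 1 0 := by
  have h2 : 0 < 2 - α := by linarith
  have h3 : 0 < 3 - α := by linarith
  have hX : 0 < 2 - α / 2 := by linarith
  have hY : 0 < 3 / 2 - α / 2 := by linarith
  have ha : ∫ s in (0:ℝ)..(1/2), (s - 1/3) * (((1:ℕ) : ℝ) + (1 - α/2) - s) ^ (1 - α) = _ :=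
    (intervalIntegral.integral_congr fun s _ => by
      push_cast; ring_nf).trans
      (integral_affine_mul_sub_rpow (X := 2 - α / 2) (h := 1 / 2) (p := 1 - α) (-1 / 3) 1 hX
        (by linarith) (by linarith))
  have hc : ∫ s in (0:ℝ)..(1/2), (1 - s) * (((1:ℕ) : ℝ) + (1 - α/2) - s) ^ (1 - α) = _ :=
    (intervalIntegral.integral_congr fun s _ => by
      push_cast; ring_nf).trans
      (integral_affine_mul_sub_rpow (X := 2 - α / 2) (h := 1 / 2) (p := 1 - α) 1 (-1) hX
        (by linarith) (by linarith))
  have hdiff : cCoef α (1 - α/2) τ 1 0 - cCoef α (1 - α/2) τ 1 1 =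
      (1 - (1 - α/2)) * (1 + (1 - α/2)) ^ (2 - α) * τ ^ (2 - α) /
        ((2 - α) * (3 - α)) := by
    simp only [cCoef, aCoef, bCoef, zero_ne_one, if_false, if_true, Nat.sub_zero]
    rw [ha, hc, integral_rpow (Or.inl (by linarith)), show 1 - α + 1 = 2 - α by ring,
      show 1 - α + 2 = 2 - α + 1 by ring, show 1 - α / 2 + 1 / 2 = 3 / 2 - α / 2 by ring,
      show 2 - α / 2 - 1 / 2 = 3 / 2 - α / 2 by ring, show 1 + (1 - α / 2) = 2 - α / 2 by ring,
      Real.zero_rpow h2.ne', Real.rpow_add_one hX.ne', Real.rpow_add_one hY.ne',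
      show 2 - α + 1 = 3 - α by ring]
    field_simp
    ring
  refine ⟨hdiff, sub_pos.1 ?_⟩
  rw [hdiff]
  have hσ : 0 < 1 - (1 - α / 2) := by linarith
  have hσ' : 0 < 1 + (1 - α / 2) := by linarith
  positivity
end

section
/- Let α ∈ (1,2), σ = 1 - α/2, τ > 0, and let k ≥ 2 be an integer. Then the sequence b_l^{(k,α)} is strictly increasing in l: b_l^{(k,α)} < b_{l+1}^{(k,α)} for every 1 ≤ l ≤ k - 1; in particular b_{k-1}^{(k,α)} < b_k^{(k,α)}. -/
open MeasureTheory Finset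

theorem continuousOn_weight_mul_sub_rpow {A : ℝ} (hA : 1 < A) (q : ℝ) :
    ContinuousOn (fun s : ℝ => (3/2 - s) * (A - s) ^ q) (Set.Icc 0 1) := by
  refine ContinuousOn.mul (by fun_prop) (ContinuousOn.rpow_const (by fun_prop) ?_)
  intro s hs
  left
  linarith [hs.2]

theorem integral_weight_mul_sub_rpow_lt {A B q : ℝ} (hA : 1 < A) (hAB : A < B) (hq : q < 0) :
    ∫ s in (0:ℝ)..1, (3/2 - s) * (B - s) ^ q < ∫ s in (0:ℝ)..1, (3/2 - s) * (A - s) ^ q := by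
  have hlt : ∀ s ∈ Set.Icc (0:ℝ) 1, (3/2 - s) * (B - s) ^ q < (3/2 - s) * (A - s) ^ q := by
    intro s hs
    exact mul_lt_mul_of_pos_left
      (Real.rpow_lt_rpow_of_neg (by linarith [hs.2]) (by linarith) hq) (by linarith [hs.2])
  exact intervalIntegral.integral_lt_integral_of_continuousOn_of_le_of_exists_lt zero_lt_one
    (continuousOn_weight_mul_sub_rpow (hA.trans hAB) q) (continuousOn_weight_mul_sub_rpow hA q)
    (fun s hs => (hlt s ⟨hs.1.le, hs.2⟩).le) ⟨0, by simp, hlt 0 (by simp)⟩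

theorem integral_three_halves_sub : ∫ s in (0:ℝ)..1, (3/2 - s) = 1 := by
  rw [intervalIntegral.integral_sub (by simp) (by simp)]
  norm_num

theorem integral_weight_mul_sub_rpow_le {A q : ℝ} (hA : 1 < A) (hq : q ≤ 0) :
    ∫ s in (0:ℝ)..1, (3/2 - s) * (A - s) ^ q ≤ (A - 1) ^ q := by
  calc ∫ s in (0:ℝ)..1, (3/2 - s) * (A - s) ^ q
      ≤ ∫ s in (0:ℝ)..1, (3/2 - s) * (A - 1) ^ q := by
        refine intervalIntegral.integral_mono_on zero_le_one
          ((continuousOn_weight_mul_sub_rpow hA q).intervalIntegrable_of_Icc zero_le_one)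
          (Continuous.intervalIntegrable (by fun_prop) _ _) fun s hs => ?_
        exact mul_le_mul_of_nonneg_left
          (Real.rpow_le_rpow_of_nonpos (by linarith) (by linarith [hs.2]) hq)
          (by linarith [hs.2])
    _ = (A - 1) ^ q := by
        rw [intervalIntegral.integral_mul_const, integral_three_halves_sub, one_mul]

/-- On `[0, c]` with `c > q + 1`, the integral of `s ^ q` exceeds the value `c ^ q`. -/
theorem rpow_lt_integral_rpow_s12 {c q : ℝ} (hq : -1 < q) (hc : q + 1 < c) :
    c ^ q < ∫ s in (0:ℝ)..c, s ^ q := by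
  have hc0 : 0 < c := by linarith
  have hq1 : 0 < q + 1 := by linarith
  rw [integral_rpow (Or.inl hq), Real.zero_rpow hq1.ne', sub_zero, lt_div_iff₀ hq1,
    Real.rpow_add_one hc0.ne']
  exact mul_lt_mul_of_pos_left hc (Real.rpow_pos_of_pos hc0 q)

/-- The sequence `b_l^{(k,α)}` is strictly increasing in `l` for `1 ≤ l ≤ k-1`,
with `σ = 1 - α/2`. -/
theorem bCoef_strict_increasing (α τ : ℝ) (hα1 : 1 < α) (hα2 : α < 2)
    (hτ : 0 < τ) (k : ℕ) (hk : 2 ≤ k) :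
    ∀ l, 1 ≤ l → l ≤ k - 1 →
      bCoef α (1 - α/2) τ k l < bCoef α (1 - α/2) τ k (l+1) := by
  intro l _ hlk
  have hlk' : l < k := by omega
  have hτ' : 0 < τ ^ (2 - α) := Real.rpow_pos_of_pos hτ _
  unfold bCoef
  rw [if_neg hlk'.ne]
  split_ifs with h
  · refine mul_lt_mul_of_pos_left ?_ hτ'
    have hk' : (k : ℝ) = l + 1 := by rw [← h]; push_cast; ring
    have hle := integral_weight_mul_sub_rpow_le
      (A := (k : ℝ) + (1 - α/2) - (l : ℝ) + 1/2) (q := 1 - α) (by linarith) (by linarith)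
    refine hle.trans_lt ?_
    have hA : (k : ℝ) + (1 - α/2) - (l : ℝ) + 1/2 - 1 = 1 - α/2 + 1/2 := by
      rw [hk']; ring
    rw [hA]
    exact rpow_lt_integral_rpow_s12 (by linarith) (by linarith)
  · refine mul_lt_mul_of_pos_left ?_ hτ'
    have hk' : ((l + 1 : ℕ) : ℝ) + 1 ≤ k := by exact_mod_cast (by omega : l + 1 + 1 ≤ k)
    refine integral_weight_mul_sub_rpow_lt (by linarith) ?_ (by linarith)
    push_cast
    linarith
end

section
/- Let σ ∈ (0, 1/2), τ > 0, let k ≥ 1 be an integer, and let p : ℝ → ℝ be twice continuously differentiable on [(k-1)τ, (k+1)τ]. Then | p(t_{k+1}) − ( (3/2 − σ)[(1/2 + σ)p(t_{k+1}) + (1/2 − σ)p(t_k)] − (1/2 − σ)[(1/2 + σ)p(t_k) + (1/2 − σ)p(t_{k-1})] ) | ≤ τ² · max_{t_{k-1} ≤ s ≤ t_{k+1}} |p''(s)|. -/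
open MeasureTheory

/-- The symmetric second difference of a `C²` function with step `h` is at most `h²` times a bound
for the second derivative. -/
theorem abs_second_difference_le {f : ℝ → ℝ} (hf : ContDiff ℝ 2 f) {x h M : ℝ} (hh : 0 < h)
    (hM : ∀ s ∈ Set.Icc (x - h) (x + h), |deriv (deriv f) s| ≤ M) :
    |f (x + h) - 2 * f x + f (x - h)| ≤ h ^ 2 * M := by
  have hd : Differentiable ℝ f := hf.differentiable two_ne_zero
  have hd' : Differentiable ℝ (deriv f) :=
    ((contDiff_succ_iff_deriv (n := 1)).1 hf).2.2.differentiable one_ne_zero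
  have hg : ∀ y, HasDerivAt (fun y => f (y + h) - f y) (deriv f (y + h) - deriv f y) y := fun y =>
    ((hd (y + h)).hasDerivAt.comp_add_const y h).sub (hd y).hasDerivAt
  obtain ⟨c, ⟨hc₁, hc₂⟩, hc⟩ := exists_hasDerivAt_eq_slope (fun y => f (y + h) - f y)
    (fun y => deriv f (y + h) - deriv f y) (sub_lt_self x hh)
    (fun y _ => (hg y).continuousAt.continuousWithinAt) (fun y _ => hg y)
  obtain ⟨d, ⟨hd₁, hd₂⟩, hd⟩ := exists_deriv_eq_slope (deriv f) (lt_add_of_pos_right c hh)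
    hd'.continuous.continuousOn hd'.differentiableOn
  have key : f (x + h) - 2 * f x + f (x - h) = h ^ 2 * deriv (deriv f) d := by
    rw [hd, hc]
    simp only [sub_add_cancel, sub_sub_cancel, add_sub_cancel_left]
    field_simp
    ring
  rw [key, abs_mul, abs_of_nonneg (sq_nonneg h)]
  gcongr
  exact hM d ⟨by linarith, by linarith⟩

/-- Lemma 2.2 (linear-interpolation identity with explicit `O(τ²)` bound):
for `σ ∈ (0,1/2)` and `p` twice continuously differentiable,
`|p(t_{k+1}) - ((3/2-σ)[(1/2+σ)p(t_{k+1}) + (1/2-σ)p(t_k)]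
  - (1/2-σ)[(1/2+σ)p(t_k) + (1/2-σ)p(t_{k-1})])| ≤ τ² max |p''|`. -/
theorem linear_interp_identity (σ τ : ℝ) (hσ1 : 0 < σ) (hσ2 : σ < 1/2)
    (hτ : 0 < τ) (k : ℕ) (hk : 1 ≤ k) (p : ℝ → ℝ) (hp : ContDiff ℝ 2 p) :
    |p (((k : ℝ) + 1) * τ) -
      ((3/2 - σ) * ((1/2 + σ) * p (((k : ℝ) + 1) * τ) + (1/2 - σ) * p ((k : ℝ) * τ)) -
       (1/2 - σ) * ((1/2 + σ) * p ((k : ℝ) * τ) + (1/2 - σ) * p (((k : ℝ) - 1) * τ)))|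
    ≤ τ ^ 2 *
        sSup ((fun s => |deriv (deriv p) s|) ''
          Set.Icc (((k : ℝ) - 1) * τ) (((k : ℝ) + 1) * τ)) := by
  set a : ℝ := (k : ℝ) * τ with ha
  have e₁ : ((k : ℝ) + 1) * τ = a + τ := by rw [ha]; ring
  have e₂ : ((k : ℝ) - 1) * τ = a - τ := by rw [ha]; ring
  rw [e₁, e₂]
  set M := sSup ((fun s => |deriv (deriv p) s|) '' Set.Icc (a - τ) (a + τ))
  have hc : Continuous (deriv (deriv p)) :=
    ((contDiff_succ_iff_deriv (n := 1)).1 hp).2.2.continuous_deriv le_rfl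
  have hM : ∀ s ∈ Set.Icc (a - τ) (a + τ), |deriv (deriv p) s| ≤ M := fun s hs =>
    le_csSup (isCompact_Icc.image hc.abs).bddAbove (Set.mem_image_of_mem _ hs)
  have hfactor : p (a + τ) -
      ((3/2 - σ) * ((1/2 + σ) * p (a + τ) + (1/2 - σ) * p a) -
       (1/2 - σ) * ((1/2 + σ) * p a + (1/2 - σ) * p (a - τ)))
      = (1/2 - σ) ^ 2 * (p (a + τ) - 2 * p a + p (a - τ)) := by ring
  rw [hfactor, abs_mul, abs_of_nonneg (sq_nonneg _)]
  calc (1/2 - σ) ^ 2 * |p (a + τ) - 2 * p a + p (a - τ)|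
      ≤ 1 * |p (a + τ) - 2 * p a + p (a - τ)| := by
        gcongr
        nlinarith
    _ ≤ τ ^ 2 * M := by
        rw [one_mul]
        exact abs_second_difference_le hp hτ hM
end
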